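/- arXiv:2310.19575 — 2 statements merged into one kernel-verified Lean document; each statement's English description precedes it below -/
import Mathlib

section
/- If G is a finite group with the Magnus Property, then G has Fitting height at most 2; that is, there exists a normal subgroup N of G such that N is nilpotent and the quotient G/N is nilpotent. -/
/-- A group has the Magnus Property if any two elements with the same normal
closure are conjugate or inverse-conjugate. -/
def MagnusProperty (G : Type*) [Group G] : Prop :=
  ∀ x y : G, Subgroup.normalClosure {x} = Subgroup.normalClosure {y} →
    IsConj x y ∨ IsConj x y⁻¹


namespace MagnusProperty

open Subgroup

variable {G : Type*} [Group G]

theorem orderOf_eq (hG : MagnusProperty G) {x y : G}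
    (h : normalClosure {x} = normalClosure {y}) : orderOf x = orderOf y := by
  have key : ∀ a b : G, IsConj a b → orderOf a = orderOf b := by
    intro a b hab
    obtain ⟨c, rfl⟩ := isConj_iff.1 hab
    exact (MulEquiv.orderOf_eq (MulAut.conj c) a).symm
  rcases hG x y h with h | h
  · exact key _ _ h
  · rw [key _ _ h, orderOf_inv]

theorem of_mulEquiv {G' : Type*} [Group G'] (hG : MagnusProperty G) (e : G ≃* G') :
    MagnusProperty G' := by
  intro x y hxy
  have hmap : ∀ z : G', (normalClosure {z}).map e.symm.toMonoidHom
      = normalClosure {e.symm z} := by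
    intro z
    rw [map_normalClosure _ _ e.symm.surjective, Set.image_singleton]
    rfl
  have := hG (e.symm x) (e.symm y) (by rw [← hmap, ← hmap, hxy])
  refine this.imp (fun h => ?_) fun h => ?_
  · simpa using e.toMonoidHom.map_isConj h
  · simpa using e.toMonoidHom.map_isConj h

theorem quotient [Finite G] (hG : MagnusProperty G) (N : Subgroup G) [N.Normal] :
    MagnusProperty (G ⧸ N) := by
  intro a b hab
  let S : Set (Subgroup G) :=
    {X | X.Normal ∧ X.map (QuotientGroup.mk' N) = normalClosure {a}}
  have hS : S.Nonempty := by
    refine ⟨(normalClosure {a}).comap (QuotientGroup.mk' N), inferInstance, ?_⟩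
    exact map_comap_eq_self_of_surjective (QuotientGroup.mk'_surjective N) _
  obtain ⟨X, hX⟩ := Set.Finite.exists_minimal (Set.toFinite S) hS
  have hXn : X.Normal := hX.1.1
  have lift : ∀ c : G ⧸ N, normalClosure {c} = normalClosure {a} →
      ∃ x : G, QuotientGroup.mk' N x = c ∧ normalClosure {x} = X := by
    intro c hc
    have hcX : c ∈ X.map (QuotientGroup.mk' N) := by
      rw [hX.1.2, ← hc]
      exact subset_normalClosure (Set.mem_singleton _)
    obtain ⟨x, hx, rfl⟩ := hcX
    have hle : normalClosure {x} ≤ X := normalClosure_le_normal (by simpa using hx)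
    refine ⟨x, rfl, le_antisymm hle (hX.2 ⟨inferInstance, ?_⟩ hle)⟩
    rw [map_normalClosure _ _ (QuotientGroup.mk'_surjective N), Set.image_singleton, hc]
  obtain ⟨x, rfl, hx⟩ := lift a rfl
  obtain ⟨y, rfl, hy⟩ := lift b hab.symm
  refine (hG x y (hx.trans hy.symm)).imp (fun h => ?_) fun h => ?_
  · exact (QuotientGroup.mk' N).map_isConj h
  · simpa using (QuotientGroup.mk' N).map_isConj h

/-- An element commuting with `x`, of order coprime to that of `x`, lies in the normal closure
of `x` only if it is trivial. -/
theorem eq_one_of_commute_of_coprime [Finite G] (hG : MagnusProperty G) {x n : G}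
    (hcomm : Commute x n) (hco : (orderOf x).Coprime (orderOf n))
    (hn : n ∈ normalClosure {x}) : n = 1 := by
  have hxmem : x ∈ normalClosure {x} := subset_normalClosure (Set.mem_singleton _)
  have hz : x ∈ zpowers (x * n) := by
    have h1 : (x * n) ^ orderOf n = x ^ orderOf n := by
      rw [hcomm.mul_pow, pow_orderOf_eq_one, mul_one]
    have h2 : x ∈ zpowers (x ^ orderOf n) := by
      obtain ⟨m, hm⟩ := exists_pow_eq_self_of_coprime hco.symm
      exact ⟨m, by simpa using hm⟩
    rw [← h1] at h2
    exact (zpowers_le.2 (pow_mem (mem_zpowers _) _)) h2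
  have heq : normalClosure {x * n} = normalClosure {x} := by
    apply le_antisymm
    · refine normalClosure_le_normal ?_
      rw [Set.singleton_subset_iff]
      exact mul_mem hxmem hn
    · refine normalClosure_le_normal ?_
      rw [Set.singleton_subset_iff]
      exact (zpowers_le.2 (subset_normalClosure (Set.mem_singleton _))) hz
  have := hG.orderOf_eq heq
  rw [hcomm.orderOf_mul_eq_mul_orderOf_of_coprime hco] at this
  exact orderOf_eq_one_iff.1 ((Nat.mul_eq_left (orderOf_pos x).ne').1 this)

/-- A minimal normal subgroup of a group with the Magnus property has prime exponent. -/
theorem exists_prime_pow_eq_one [Finite G] (hG : MagnusProperty G) {N : Subgroup G} [N.Normal]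
    (hN : N ≠ ⊥) (hmin : ∀ L : Subgroup G, L.Normal → L ≠ ⊥ → L ≤ N → L = N) :
    ∃ p : ℕ, p.Prime ∧ ∀ x ∈ N, x ^ p = 1 := by
  have hcl : ∀ x ∈ N, x ≠ 1 → normalClosure {x} = N := by
    intro x hx hx1
    refine hmin _ inferInstance ?_ (normalClosure_le_normal (by simpa using hx))
    intro h
    exact hx1 (by simpa using (h ▸ subset_normalClosure (Set.mem_singleton _) : x ∈ (⊥ : Subgroup G)))
  have hcard : Nat.card N ≠ 1 := fun h => hN (card_eq_one.1 h)
  obtain ⟨p, hp, hpd⟩ := Nat.exists_prime_and_dvd hcard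
  have : Fact p.Prime := ⟨hp⟩
  obtain ⟨⟨x, hxN⟩, hx⟩ := exists_prime_orderOf_dvd_card' p hpd
  rw [orderOf_mk] at hx
  have hx1 : x ≠ 1 := by
    rintro rfl
    exact hp.one_lt.ne (by simpa using hx)
  refine ⟨p, hp, fun y hy => ?_⟩
  by_cases hy1 : y = 1
  · simp [hy1]
  · rw [← hx, hG.orderOf_eq ((hcl x hxN hx1).trans (hcl y hy hy1).symm), pow_orderOf_eq_one]

theorem _root_.Subgroup.exists_minimal_normal_le [Finite G] {K : Subgroup G} [K.Normal]
    (hK : K ≠ ⊥) : ∃ N : Subgroup G, N.Normal ∧ N ≠ ⊥ ∧ N ≤ K ∧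
      ∀ L : Subgroup G, L.Normal → L ≠ ⊥ → L ≤ N → L = N := by
  obtain ⟨N, hN⟩ := Set.Finite.exists_minimal
    (Set.toFinite {X : Subgroup G | X.Normal ∧ X ≠ ⊥ ∧ X ≤ K}) ⟨K, inferInstance, hK, le_rfl⟩
  exact ⟨N, hN.1.1, hN.1.2.1, hN.1.2.2, fun L h1 h2 h3 =>
    le_antisymm h3 (hN.2 ⟨h1, h2, h3.trans hN.1.2.2⟩ h3)⟩

end MagnusProperty

section CommutatorCalculus

variable {G : Type*} [Group G]

theorem mul_pow_of_semiconj {g t c : G} (h : t * g = g * c * t) (hg : Commute c g)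
    (ht : Commute c t) (n : ℕ) : (g * t) ^ n = g ^ n * t ^ n * c ^ n.choose 2 := by
  have hmove : ∀ n : ℕ, t ^ n * g = g * t ^ n * c ^ n := by
    intro n
    induction n with
    | zero => simp
    | succ n ih =>
      calc t ^ (n + 1) * g = t ^ n * (t * g) := by rw [pow_succ, mul_assoc]
        _ = t ^ n * g * (c * t) := by rw [h]; simp only [mul_assoc]
        _ = g * t ^ n * (c ^ n * c * t) := by rw [ih]; simp only [mul_assoc]
        _ = g * t ^ n * (c ^ (n + 1) * t) := by rw [pow_succ c]
        _ = g * t ^ (n + 1) * c ^ (n + 1) := by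
          rw [(ht.pow_left (n + 1)).eq, pow_succ t]; simp only [mul_assoc]
  induction n with
  | zero => simp
  | succ n ih =>
    calc (g * t) ^ (n + 1) = g ^ n * t ^ n * (c ^ n.choose 2 * (g * t)) := by
          rw [pow_succ, ih]; simp only [mul_assoc]
      _ = g ^ n * (t ^ n * g) * t * c ^ n.choose 2 := by
          rw [((hg.mul_right ht).pow_left _).eq]; simp only [mul_assoc]
      _ = g ^ n * g * t ^ n * (c ^ n * t) * c ^ n.choose 2 := by
          rw [hmove]; simp only [mul_assoc]
      _ = g ^ (n + 1) * t ^ (n + 1) * (c ^ n * c ^ n.choose 2) := by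
          rw [(ht.pow_left n).eq, pow_succ, pow_succ]; simp only [mul_assoc]
      _ = g ^ (n + 1) * t ^ (n + 1) * c ^ (n + 1).choose 2 := by
          rw [← pow_add, Nat.choose_succ_succ' n 1, Nat.choose_one_right]

theorem semiconj_zpow_right {g t c : G} (h : t * g = g * c * t) (hg : Commute c g) (n : ℤ) :
    t * g ^ n = g ^ n * c ^ n * t := by
  have : SemiconjBy t g (g * c) := h
  rw [(this.zpow_right n).eq, hg.symm.mul_zpow]

theorem semiconj_pow_left {g t c : G} (h : t * g = g * c * t) (ht : Commute c t) (n : ℕ) :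
    t ^ n * g = g * c ^ n * t ^ n := by
  induction n with
  | zero => simp
  | succ n ih =>
    calc t ^ (n + 1) * g = t ^ n * (t * g) := by rw [pow_succ, mul_assoc]
      _ = t ^ n * g * (c * t) := by rw [h]; simp only [mul_assoc]
      _ = g * c ^ n * (t ^ n * c) * t := by rw [ih]; simp only [mul_assoc]
      _ = g * c ^ n * (c * t ^ n) * t := by rw [(ht.pow_right n).eq]
      _ = g * c ^ (n + 1) * t ^ (n + 1) := by
        rw [pow_succ c, pow_succ t]; simp only [mul_assoc]

end CommutatorCalculus

/-- For every prime `s`, the group has at most one subgroup of order `s`. -/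
def UniquePrimeSubgroups (G : Type*) [Group G] : Prop :=
  ∀ s : ℕ, s.Prime → ∀ a b : G, orderOf a = s → b ^ s = 1 → b ∈ Subgroup.zpowers a

namespace UniquePrimeSubgroups

open Subgroup

variable {G : Type*} [Group G]

theorem orderOf_pow_prime_pow {s K : ℕ} (hs : s.Prime) {y : G} (hy : orderOf y = s ^ (K + 1)) :
    orderOf (y ^ s ^ K) = s := by
  rw [orderOf_pow_of_dvd (pow_ne_zero _ hs.ne_zero) (hy ▸ pow_dvd_pow s K.le_succ), hy,
    pow_succ, Nat.mul_div_cancel_left _ (pow_pos hs.pos K)]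

theorem mem_zpowers_of_pow_eq_one (hU : UniquePrimeSubgroups G) {s K : ℕ} (hs : s.Prime) {y b : G}
    (hy : orderOf y = s ^ (K + 1)) (hb : b ^ s = 1) : b ∈ zpowers y :=
  (zpowers_le.2 (pow_mem (mem_zpowers y) _))
    (hU s hs _ b (orderOf_pow_prime_pow hs hy) hb)

theorem mem_zpowers_of_commute (hU : UniquePrimeSubgroups G) {s k : ℕ} (hs : s.Prime) {a : G}
    (ha : orderOf a = s ^ k) (j : ℕ) (hjk : j ≤ k) (b : G) (hab : Commute a b)
    (hb : b ^ s ^ j = 1) : b ∈ zpowers a := by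
  induction j generalizing b with
  | zero => simp_all [one_mem]
  | succ j ih =>
    obtain ⟨k, rfl⟩ : ∃ k', k = k' + 1 := ⟨k - 1, by omega⟩
    obtain ⟨e, he⟩ := mem_zpowers_iff.1
      (ih (by omega) (b ^ s) (hab.pow_right s) (by rw [← pow_mul, ← pow_succ']; exact hb))
    have h1 : (a ^ e) ^ s ^ j = 1 := by rw [he, ← pow_mul, ← pow_succ', hb]
    have h2 : ((s ^ (k + 1) : ℕ) : ℤ) ∣ e * (s ^ j : ℕ) := by
      rw [← ha, orderOf_dvd_iff_zpow_eq_one, zpow_mul, zpow_natCast, h1]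
    have h3 : (s : ℤ) ∣ e := by
      have h4 : ((s ^ (j + 1) : ℕ) : ℤ) ∣ e * (s ^ j : ℕ) :=
        (Int.natCast_dvd_natCast.2 (pow_dvd_pow s hjk)).trans h2
      rw [pow_succ', Nat.cast_mul] at h4
      exact Int.dvd_of_mul_dvd_mul_right (by exact_mod_cast pow_ne_zero j hs.ne_zero) h4
    obtain ⟨f, rfl⟩ := h3
    have hc : (a ^ (-f) * b) ^ s = 1 := by
      rw [(hab.zpow_left (-f)).mul_pow, ← he, ← zpow_natCast, ← zpow_mul, ← zpow_add]
      convert zpow_zero a using 2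
      ring
    have := mul_mem (zpow_mem (mem_zpowers a) f) (hU.mem_zpowers_of_pow_eq_one hs ha hc)
    simpa [← mul_assoc] using this

theorem commute_of_mul_pow_eq_one (hU : UniquePrimeSubgroups G) {s K : ℕ} (hs : s.Prime) {y t : G}
    (hy : orderOf y = s ^ (K + 1)) (n : ℤ) (h : (y ^ n * t) ^ s = 1) : Commute t y := by
  obtain ⟨m, hm⟩ := mem_zpowers_iff.1 (hU.mem_zpowers_of_pow_eq_one hs hy h)
  have ht : t = y ^ (-n + m) := by rw [zpow_add, hm]; simp
  rw [ht]
  exact (Commute.refl y).zpow_left _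

theorem exists_maximal_prime_power [Finite G] {s k : ℕ} (hs : s.Prime) {h : G}
    (hk : s ^ k ∣ orderOf h) : ∃ (y : G) (K : ℕ), k ≤ K ∧ orderOf y = s ^ K ∧
      ∀ (b : G) (a : ℕ), b ^ s ^ a = 1 → b ^ s ^ K = 1 := by
  obtain ⟨y, ⟨K, hK⟩, hmax⟩ := Set.exists_max_image {y : G | ∃ k, orderOf y = s ^ k} orderOf
    (Set.toFinite _) ⟨1, 0, by simp⟩
  refine ⟨y, K, ?_, hK, fun b a hb => ?_⟩
  · have := hmax (h ^ (orderOf h / s ^ k)) ⟨k, orderOf_pow_orderOf_div (orderOf_pos h).ne' hk⟩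
    rw [orderOf_pow_orderOf_div (orderOf_pos h).ne' hk, hK] at this
    exact (Nat.pow_le_pow_iff_right hs.one_lt).1 this
  · obtain ⟨j, -, hj⟩ := (Nat.dvd_prime_pow hs).1 (orderOf_dvd_of_pow_eq_one hb)
    have := hmax b ⟨j, hj⟩
    rw [hj, hK] at this
    rw [← orderOf_dvd_iff_pow_eq_one, hj]
    exact pow_dvd_pow s ((Nat.pow_le_pow_iff_right hs.one_lt).1 this)

/-- If `y` generates a maximal cyclic `s`-subgroup, an `s`-element `t` cannot act on it by
multiplying `y` by a nontrivial element of order `s`, provided the equation `hb` is solvable. -/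
theorem false_of_semiconj (hU : UniquePrimeSubgroups G) {s K : ℕ} (hs : s.Prime) {y t c : G}
    (hy : orderOf y = s ^ (K + 1)) (hmax : ∀ (b : G) (a : ℕ), b ^ s ^ a = 1 → b ^ s ^ (K + 1) = 1)
    (ht : ∃ a : ℕ, t ^ s ^ a = 1) (h : t * y = y * c * t) (hcy : Commute c y) (hct : Commute c t)
    (hcs : c ^ s = 1) (hc : c ≠ 1)
    (hb : ∀ e : ℤ, ∃ n : ℤ, y ^ (s * n + s * e) * (c ^ n) ^ s.choose 2 = 1) : False := by
  obtain ⟨a, ha⟩ := ht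
  have hcomm : Commute y (t ^ s) := by
    have := semiconj_pow_left h hct s
    rw [hcs, mul_one] at this
    exact this.symm
  obtain ⟨e, he⟩ := mem_zpowers_iff.1 (hU.mem_zpowers_of_commute hs hy (K + 1) le_rfl (t ^ s) hcomm
    (hmax _ a (by rw [← pow_mul, mul_comm, pow_mul, ha, one_pow])))
  have hce : c ^ e = 1 := by
    have h1 := semiconj_zpow_right h hcy e
    have h2 : t * y ^ e = y ^ e * t := by rw [he, ← pow_succ, ← pow_succ']
    rw [h2] at h1
    simpa using h1
  have hso : orderOf c = s := orderOf_eq_prime_iff (hp := ⟨hs⟩) |>.2 ⟨hcs, hc⟩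
  rw [← orderOf_dvd_iff_zpow_eq_one, hso] at hce
  obtain ⟨f, rfl⟩ := hce
  obtain ⟨n, hn⟩ := hb f
  have hcom : Commute t y := by
    refine hU.commute_of_mul_pow_eq_one hs hy n ?_
    rw [mul_pow_of_semiconj (semiconj_zpow_right h hcy n) ((hcy.zpow_left n).zpow_right n)
      (hct.zpow_left n), ← he, ← hn, zpow_add, mul_comm (s : ℤ) n, zpow_mul y n s, zpow_natCast]
  rw [hcom.eq] at h
  have : y * t = y * (c * t) := by rw [h, mul_assoc]
  simp at this
  exact hc this

end UniquePrimeSubgroups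

namespace MagnusProperty

open Subgroup

variable {G : Type*} [Group G]

theorem exists_semiconjBy_of_mem_zpowers (hG : MagnusProperty G) {a b : G} (hab : a ∈ zpowers b)
    (hba : b ∈ zpowers a) : ∃ t : G, SemiconjBy t a b ∨ SemiconjBy t a b⁻¹ := by
  have hle : ∀ x y : G, x ∈ zpowers y → normalClosure {x} ≤ normalClosure {y} := by
    intro x y hxy
    refine normalClosure_le_normal ?_
    rw [Set.singleton_subset_iff]
    exact (zpowers_le.2 (subset_normalClosure (Set.mem_singleton y))) hxy
  rcases hG a b (le_antisymm (hle _ _ hab) (hle _ _ hba)) with h | h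
  · obtain ⟨t, ht⟩ := isConj_iff.1 h
    exact ⟨t, Or.inl (mul_inv_eq_iff_eq_mul.1 ht)⟩
  · obtain ⟨t, ht⟩ := isConj_iff.1 h
    exact ⟨t, Or.inr (mul_inv_eq_iff_eq_mul.1 ht)⟩

theorem exists_semiconjBy_pow [Finite G] (hG : MagnusProperty G) {y : G} {v : ℕ}
    (hv : v.Coprime (orderOf y)) :
    ∃ t : G, SemiconjBy t y (y ^ v) ∨ SemiconjBy t y (y ^ v)⁻¹ := by
  refine hG.exists_semiconjBy_of_mem_zpowers ?_ (pow_mem (mem_zpowers y) v)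
  obtain ⟨m, hm⟩ := exists_pow_eq_self_of_coprime hv
  exact ⟨m, by simpa using hm⟩

theorem exists_semiconjBy_mul_pow [Finite G] (hG : MagnusProperty G) {s K : ℕ}
    {y : G} (hy : orderOf y = s ^ (K + 2)) :
    ∃ t : G, SemiconjBy t y (y * y ^ s ^ (K + 1)) ∨ SemiconjBy t y (y * y ^ s ^ (K + 1))⁻¹ := by
  rw [← pow_succ']
  refine hG.exists_semiconjBy_pow ?_
  rw [hy]
  refine Nat.Coprime.pow_right _ ?_
  rw [pow_succ']
  simp

theorem not_prime_sq_dvd_orderOf [Finite G] (hG : MagnusProperty G) (hU : UniquePrimeSubgroups G)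
    {s : ℕ} (hs : s.Prime) (hs2 : s ≠ 2) (h : G) : ¬ s ^ 2 ∣ orderOf h := by
  intro hdvd
  obtain ⟨y, K, hK, hy, hmax⟩ := UniquePrimeSubgroups.exists_maximal_prime_power hs hdvd
  obtain ⟨K, rfl⟩ := Nat.exists_eq_add_of_le' hK
  set z := y ^ s ^ (K + 1) with hz
  have hzo : orderOf z = s := UniquePrimeSubgroups.orderOf_pow_prime_pow hs hy
  have hzs : z ^ s = 1 := hzo ▸ pow_orderOf_eq_one z
  have hyz : Commute y z := Commute.self_pow y _
  have hpow : (y * z) ^ s ^ (K + 1) = z := by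
    rw [hyz.mul_pow, pow_succ' s K, pow_mul z, hzs, one_pow, mul_one, ← pow_succ']
  obtain ⟨t, ht⟩ : ∃ t : G, SemiconjBy (t * t) y (y * (z * z)) ∧ Commute (t * t) z := by
    obtain ⟨t, ht | ht⟩ := hG.exists_semiconjBy_mul_pow hy
    · have h1 : SemiconjBy t z z := by
        have := ht.pow_right (s ^ (K + 1))
        rwa [hpow] at this
      refine ⟨t, ?_, h1.mul_left h1⟩
      have := (ht.mul_right h1).mul_left ht
      rwa [mul_assoc] at this
    · have h1 : SemiconjBy t z z⁻¹ := by
        have := ht.pow_right (s ^ (K + 1))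
        rwa [inv_pow, hpow] at this
      refine ⟨t, ?_, ?_⟩
      · have := ((ht.mul_right h1).inv_right).mul_left ht
        rwa [mul_inv_rev, inv_inv, inv_inv, ← mul_assoc, ← hyz.eq, mul_assoc] at this
      · have := h1.inv_right.mul_left h1
        rwa [inv_inv] at this
  obtain ⟨a, m, hm, hcard⟩ :=
    Nat.exists_eq_pow_mul_and_not_dvd (Nat.card_pos (α := G)).ne' s hs.ne_one
  have hzt : Commute (z * z) (t * t) := (ht.2.mul_right ht.2).symm
  have hcs : ((z * z) ^ m) ^ s = 1 := by
    rw [← pow_mul, mul_comm m, pow_mul, (Commute.refl z).mul_pow, hzs, one_mul, one_pow]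
  refine hU.false_of_semiconj hs hy (t := (t * t) ^ m) (c := (z * z) ^ m) hmax
    ⟨a, ?_⟩ (semiconj_pow_left ht.1 hzt m) ?_ (hzt.pow_pow _ _) hcs ?_ ?_
  · rw [← pow_mul, mul_comm, ← hcard]
    exact pow_card_eq_one'
  · exact ((hyz.mul_right hyz).pow_right m).symm
  · rw [← pow_two, ← pow_mul]
    intro h1
    rw [← orderOf_dvd_iff_pow_eq_one, hzo, hs.dvd_mul] at h1
    exact h1.elim (fun h => hs2 ((Nat.prime_dvd_prime_iff_eq hs Nat.prime_two).1 h)) hm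
  · intro e
    refine ⟨-e, ?_⟩
    obtain ⟨w, hw⟩ := hs.dvd_choose_self (k := 2) two_ne_zero
      (lt_of_le_of_ne hs.two_le hs2.symm)
    have h2 : (((z * z) ^ m) ^ (-e)) ^ s = 1 := by
      rw [← zpow_natCast, ← zpow_mul, mul_comm (-e), zpow_mul, zpow_natCast, hcs, one_zpow]
    rw [hw, pow_mul, h2]
    simp

theorem not_eight_dvd_orderOf [Finite G] (hG : MagnusProperty G) (hU : UniquePrimeSubgroups G)
    (h : G) : ¬ 8 ∣ orderOf h := by
  intro hdvd
  obtain ⟨y, K, hK, hy, hmax⟩ :=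
    UniquePrimeSubgroups.exists_maximal_prime_power (k := 3) Nat.prime_two hdvd
  obtain ⟨K, rfl⟩ := Nat.exists_eq_add_of_le' hK
  set z := y ^ 2 ^ (K + 2) with hz
  have hzo : orderOf z = 2 := UniquePrimeSubgroups.orderOf_pow_prime_pow Nat.prime_two hy
  have hzs : z ^ 2 = 1 := hzo ▸ pow_orderOf_eq_one z
  have hz1 : z ≠ 1 := fun h => by simp [h] at hzo
  have hzinv : z⁻¹ = z := inv_eq_of_mul_eq_one_left (by rw [← pow_two, hzs])
  have hyz : Commute y z := Commute.self_pow y _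
  have hpow : (y * z) ^ 2 ^ (K + 2) = z := by
    rw [hyz.mul_pow, pow_succ' 2 (K + 1), pow_mul z, hzs, one_pow, mul_one, ← pow_succ']
  have hzeven : ∀ n : ℤ, 2 ∣ n → z ^ n = 1 := by
    rintro n ⟨l, rfl⟩
    rw [zpow_mul, zpow_ofNat, hzs, one_zpow]
  obtain ⟨a, m, hm, hcard⟩ :=
    Nat.exists_eq_pow_mul_and_not_dvd (Nat.card_pos (α := G)).ne' 2 (by norm_num)
  obtain ⟨l, rfl⟩ : Odd m := by rwa [← Nat.not_even_iff_odd, even_iff_two_dvd]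
  have hzm : z ^ (2 * l + 1) = z := by rw [pow_succ, pow_mul, hzs, one_pow, one_mul]
  have hcardpow : ∀ t : G, (t ^ (2 * l + 1)) ^ 2 ^ a = 1 := fun t => by
    rw [← pow_mul, mul_comm, ← hcard]
    exact pow_card_eq_one'
  obtain ⟨t, ht | ht⟩ := hG.exists_semiconjBy_mul_pow (K := K + 1) hy
  · have htz : Commute t z := by
      have := ht.pow_right (2 ^ (K + 2))
      rwa [hpow] at this
    have h1 := semiconj_pow_left ht htz.symm (2 * l + 1)
    rw [← hz, hzm] at h1
    refine hU.false_of_semiconj Nat.prime_two hy hmax ⟨a, hcardpow t⟩ h1 hyz.symm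
      (htz.symm.pow_right _) hzs hz1 fun e => ⟨e * (-1 + 2 ^ (K + 1)), ?_⟩
    have h2 : ((2 : ℕ) : ℤ) * (e * (-1 + 2 ^ (K + 1))) + (2 : ℕ) * e
        = (2 ^ (K + 2) : ℕ) * e := by push_cast; ring
    rw [h2, zpow_mul, zpow_natCast, ← hz, Nat.choose_self, pow_one, ← zpow_add]
    apply hzeven
    exact ⟨e * 2 ^ K, by ring⟩
  · have htz : Commute t z := by
      have := ht.pow_right (2 ^ (K + 2))
      rwa [inv_pow, hpow, hzinv] at this
    have htt : Commute (t * t) y := by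
      have := (((ht.mul_right htz).inv_right).mul_left ht)
      rwa [mul_inv_rev, inv_inv, hzinv, ← hz, ← mul_assoc, ← hyz.eq, mul_assoc, ← pow_two z, hzs,
        mul_one] at this
    set T := t ^ (2 * l + 1) with hT
    have hTy : SemiconjBy T y (y * z)⁻¹ := by
      have h3 : Commute (t ^ (2 * l)) y := by
        rw [pow_mul, pow_two]
        exact htt.pow_left l
      rw [hT, pow_succ']
      exact SemiconjBy.mul_left ht h3
    have hTT : Commute y (T ^ 2) := by
      rw [hT, ← pow_mul, mul_comm, pow_mul, pow_two]
      exact (htt.pow_left _).symm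
    obtain ⟨e, he⟩ := mem_zpowers_iff.1 (hU.mem_zpowers_of_commute Nat.prime_two hy (K + 3) le_rfl
      (T ^ 2) hTT (hmax _ a (by rw [← pow_mul, mul_comm, pow_mul, hcardpow, one_pow])))
    have hye : y ^ e * y ^ e = z ^ e := by
      have h4 := (hTy.zpow_right e).eq
      have h5 : T * y ^ e = y ^ e * T := by rw [he, ← pow_succ, ← pow_succ']
      rw [h5, mul_left_inj, inv_zpow, hyz.mul_zpow, mul_inv_rev, ← inv_zpow, hzinv] at h4
      nth_rewrite 1 [h4]
      simp
    have h8 : ((2 ^ (K + 3) : ℕ) : ℤ) ∣ 4 * e := by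
      rw [← hy, orderOf_dvd_iff_zpow_eq_one]
      have : (4 : ℤ) * e = e + e + (e + e) := by ring
      rw [this, zpow_add, zpow_add, hye, ← zpow_add, hzeven _ ⟨e, by ring⟩]
    have he2 : 2 ∣ e := by
      have : (8 : ℤ) ∣ 4 * e := by
        refine Dvd.dvd.trans ⟨2 ^ K, ?_⟩ h8
        push_cast
        ring
      omega
    rw [hzeven e he2] at hye
    have hyez : ∃ n : ℤ, z ^ n * y ^ e = 1 := by
      obtain ⟨n, hn⟩ := mem_zpowers_iff.1 (hU 2 Nat.prime_two z (y ^ e) hzo (by rw [pow_two, hye]))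
      exact ⟨-n, by rw [← hn]; simp⟩
    obtain ⟨n, hn⟩ := hyez
    have hcom : Commute T y := by
      refine hU.commute_of_mul_pow_eq_one Nat.prime_two hy n ?_
      have h6 := (hTy.zpow_right n).eq
      rw [inv_zpow, hyz.mul_zpow, mul_inv_rev, ← inv_zpow, hzinv] at h6
      calc (y ^ n * T) ^ 2 = y ^ n * (T * y ^ n) * T := by rw [pow_two]; simp only [mul_assoc]
        _ = y ^ n * z ^ n * (y ^ n)⁻¹ * T ^ 2 := by rw [h6, pow_two]; simp only [mul_assoc]
        _ = z ^ n * y ^ e := by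
          rw [((hyz.zpow_left n).zpow_right n).eq, he]; simp only [mul_assoc, mul_inv_cancel_left]
        _ = 1 := hn
    have h7 : y = (y * z)⁻¹ := by
      have := hTy.eq
      rw [hcom.eq, mul_left_inj] at this
      exact this
    have h9 : y ^ 4 = 1 := by
      have h10 : y * y = z := by
        nth_rewrite 1 [h7]
        rw [mul_inv_rev, hzinv, inv_mul_cancel_right]
      rw [show 4 = 2 * 2 from rfl, pow_mul, pow_two y, h10, hzs]
    rw [← orderOf_dvd_iff_pow_eq_one, hy] at h9
    have := Nat.le_of_dvd (by norm_num) h9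
    have h11 : 2 ^ 3 ≤ 2 ^ (K + 3) := Nat.pow_le_pow_right (by norm_num) (by omega)
    omega

end MagnusProperty

namespace UniquePrimeSubgroups

open Subgroup

variable {G : Type*} [Group G]

theorem normal_zpowers (hU : UniquePrimeSubgroups G) {x : G} (hx : (orderOf x).Prime) :
    (zpowers x).Normal := by
  refine ⟨fun a ha g => ?_⟩
  have h1 : g * x * g⁻¹ ∈ zpowers x := by
    refine hU _ hx x _ rfl ?_
    rw [conj_pow, pow_orderOf_eq_one, mul_one, mul_inv_cancel]
  obtain ⟨n, rfl⟩ := mem_zpowers_iff.1 ha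
  rw [← conj_zpow]
  exact zpow_mem h1 n

theorem commute_of_prime (hU : UniquePrimeSubgroups G) {a x : G} (ha : (orderOf a).Prime)
    (hx : (orderOf x).Prime) : Commute a x := by
  by_cases h : orderOf a = orderOf x
  · obtain ⟨n, rfl⟩ := mem_zpowers_iff.1 (hU _ hx x a rfl (by rw [← h, pow_orderOf_eq_one]))
    exact (Commute.refl x).zpow_left n
  · refine commute_of_normal_of_disjoint _ _ (hU.normal_zpowers ha) (hU.normal_zpowers hx)
      (disjoint_of_coprime_natCard ?_) a x (mem_zpowers a) (mem_zpowers x)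
    rw [Nat.card_zpowers, Nat.card_zpowers]
    exact (Nat.coprime_primes ha hx).2 h

end UniquePrimeSubgroups

namespace MagnusProperty

open Subgroup

variable {G : Type*} [Group G] [Finite G]

theorem commute_sq_of_prime (hG : MagnusProperty G) (hU : UniquePrimeSubgroups G) {x : G}
    (hx : (orderOf x).Prime) (h : G) : Commute (h ^ 2) x := by
  have : (zpowers x).Normal := hU.normal_zpowers hx
  let f : G →* MulAut (zpowers x) := MulAut.conjNormal
  have hf : ∀ c : G, f c = 1 ↔ Commute c x := by
    intro c
    constructor
    · intro hc
      have h1 : c * x * c⁻¹ = x := by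
        have := MulAut.conjNormal_apply c (⟨x, mem_zpowers x⟩ : zpowers x)
        rw [show MulAut.conjNormal c = (1 : MulAut (zpowers x)) from hc] at this
        exact this.symm
      exact mul_inv_eq_iff_eq_mul.1 h1
    · intro hc
      ext ⟨b, hb⟩
      obtain ⟨n, rfl⟩ := mem_zpowers_iff.1 hb
      rw [MulAut.conjNormal_apply]
      simpa using mul_inv_eq_iff_eq_mul.2 (hc.zpow_right n).eq
  by_contra hc
  rw [← hf, ← orderOf_eq_one_iff] at hc
  obtain ⟨s, hs, hsd⟩ := Nat.exists_prime_and_dvd hc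
  have hsc : s ∣ orderOf (h ^ 2) := hsd.trans (orderOf_map_dvd f (h ^ 2))
  have hord := orderOf_pow_orderOf_div (orderOf_pos (h ^ 2)).ne' hsc
  have h1 : f ((h ^ 2) ^ (orderOf (h ^ 2) / s)) = 1 :=
    (hf _).2 (hU.commute_of_prime (by rwa [hord]) hx)
  rw [map_pow, ← orderOf_dvd_iff_pow_eq_one] at h1
  have h2 : s ^ 2 ∣ orderOf (h ^ 2) := by
    rw [pow_two]
    exact Nat.mul_dvd_of_dvd_div hsc (hsd.trans h1)
  by_cases hs2 : s = 2
  · subst hs2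
    refine hG.not_eight_dvd_orderOf hU h ?_
    have heven : 2 ∣ orderOf h := hsc.trans (orderOf_pow_dvd 2)
    rw [orderOf_pow_of_dvd two_ne_zero heven] at h2
    have := Nat.mul_dvd_of_dvd_div heven h2
    exact this
  · exact hG.not_prime_sq_dvd_orderOf hU hs hs2 _ h2

theorem pow_twelve_eq_one (hG : MagnusProperty G) (hU : UniquePrimeSubgroups G) (h : G) :
    h ^ 12 = 1 := by
  rw [← orderOf_dvd_iff_pow_eq_one, Nat.dvd_iff_prime_pow_dvd_dvd]
  intro s k hs hk
  by_cases hs2 : s = 2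
  · subst hs2
    have : k < 3 := by
      by_contra hk3
      exact hG.not_eight_dvd_orderOf hU h ((pow_dvd_pow 2 (not_lt.1 hk3)).trans hk)
    interval_cases k <;> decide
  have hk2 : k < 2 := by
    by_contra hk3
    exact hG.not_prime_sq_dvd_orderOf hU hs hs2 h ((pow_dvd_pow s (not_lt.1 hk3)).trans hk)
  interval_cases k
  · simp
  rw [pow_one] at hk ⊢
  have hxo := orderOf_pow_orderOf_div (orderOf_pos h).ne' hk
  set x := h ^ (orderOf h / s) with hx
  have hcop : Nat.Coprime 2 (orderOf x) := by
    rw [hxo]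
    exact (Nat.coprime_primes Nat.prime_two hs).2 (Ne.symm hs2)
  have key : ∃ t : G, SemiconjBy (t * t) x (x ^ 4) := by
    obtain ⟨t, ht | ht⟩ := hG.exists_semiconjBy_pow hcop
    · refine ⟨t, ?_⟩
      have := (ht.pow_right 2).mul_left ht
      rwa [← pow_mul] at this
    · refine ⟨t, ?_⟩
      have := (ht.pow_right 2).inv_right.mul_left ht
      rwa [inv_pow, inv_inv, ← pow_mul] at this
  obtain ⟨t, ht⟩ := key
  have hcomm : Commute (t * t) x := by
    rw [← pow_two]
    exact hG.commute_sq_of_prime hU (hxo.symm ▸ hs) t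
  have h4 : x ^ 3 = 1 := by
    have := ht.eq
    rw [hcomm.eq, mul_left_inj, pow_succ] at this
    simpa using this
  rw [← orderOf_dvd_iff_pow_eq_one, hxo] at h4
  exact h4.trans (by norm_num)

theorem isNilpotent_or_card_eq_twelve (hG : MagnusProperty G) (hU : UniquePrimeSubgroups G) :
    Group.IsNilpotent G ∨ (Nat.card G = 12 ∧ ∃ z : G, orderOf z = 2) := by
  have h12 := hG.pow_twelve_eq_one hU
  have : Fact (Nat.Prime 2) := ⟨Nat.prime_two⟩
  have : Fact (Nat.Prime 3) := ⟨Nat.prime_three⟩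
  by_cases h3 : ∃ x : G, orderOf x = 3
  swap
  · left
    refine IsPGroup.isNilpotent (p := 2) fun h => ⟨2, ?_⟩
    by_contra h1
    exact h3 ⟨h ^ 4, orderOf_eq_prime_iff.2 ⟨by rw [← pow_mul]; exact h12 h, h1⟩⟩
  obtain ⟨x, hx⟩ := h3
  have hxp : (orderOf x).Prime := hx.symm ▸ Nat.prime_three
  have hxn : (zpowers x).Normal := hU.normal_zpowers hxp
  have hx3 : x ^ 3 = 1 := hx ▸ pow_orderOf_eq_one x
  have hx1 : x ≠ 1 := by
    rintro rfl
    simp at hx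
  have hxinv : x ≠ x⁻¹ := by
    intro h
    apply hx1
    have h2 : x * x = 1 := by
      nth_rewrite 1 [h]
      exact inv_mul_cancel x
    rwa [pow_succ, pow_two, h2, one_mul] at hx3
  have h4 : ∀ h : G, h ^ 4 ∈ zpowers x := fun h =>
    hU 3 Nat.prime_three x _ hx (by rw [← pow_mul]; exact h12 h)
  by_cases hc : ∀ h : G, Commute h x
  · left
    have : Group.IsNilpotent (G ⧸ zpowers x) := by
      refine IsPGroup.isNilpotent (p := 2) fun h => ⟨2, ?_⟩
      obtain ⟨h, rfl⟩ := QuotientGroup.mk_surjective h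
      rw [← QuotientGroup.mk_pow, QuotientGroup.eq_one_iff]
      exact h4 h
    refine Subgroup.isNilpotent_of_ker_le_center (QuotientGroup.mk' (zpowers x)) ?_
    rw [QuotientGroup.ker_mk', zpowers_le, mem_center_iff]
    exact fun g => (hc g).eq
  right
  have hinv : ∀ h : G, ¬ Commute h x → SemiconjBy h x x⁻¹ := by
    intro h hh
    obtain ⟨n, hn⟩ := mem_zpowers_iff.1 (hxn.conj_mem x (mem_zpowers x) h)
    rw [← zpow_mod_orderOf, hx] at hn
    have hlt := Int.emod_lt_of_pos n (b := ((3 : ℕ) : ℤ)) (by norm_num)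
    have hnn := Int.emod_nonneg n (b := ((3 : ℕ) : ℤ)) (by norm_num)
    generalize n % ((3 : ℕ) : ℤ) = m at *
    have hm3 : m < 3 := hlt
    rw [eq_mul_inv_iff_mul_eq] at hn
    interval_cases m
    · exact absurd (by simpa using hn) hx1
    · exact absurd (by simpa using hn.symm : h * x = x * h) hh
    · refine hn.symm.trans ?_
      congr 1
      rw [eq_inv_iff_mul_eq_one, zpow_ofNat, ← pow_succ, hx3]
  have hsq1 : ∀ h : G, ¬ Commute h x → h ^ 2 ≠ 1 := by
    intro h hh h2
    refine hh (hU.commute_of_prime ?_ hxp)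
    rw [orderOf_eq_prime_iff.2 ⟨h2, fun h1 => hh (h1 ▸ Commute.one_left x)⟩]
    exact Nat.prime_two
  have hpow4 : ∀ h : G, ¬ Commute h x → h ^ 4 = 1 := by
    intro h hh
    obtain ⟨n, hn⟩ := mem_zpowers_iff.1 (h4 h)
    have h1 : h * x ^ n = x⁻¹ ^ n * h := (hinv h hh).zpow_right n
    have h2 : h * x ^ n = x ^ n * h := by rw [hn, ← pow_succ, ← pow_succ']
    rw [h2, mul_left_inj, inv_zpow, eq_inv_iff_mul_eq_one, ← zpow_add,
      ← orderOf_dvd_iff_zpow_eq_one, hx] at h1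
    rw [← hn, ← orderOf_dvd_iff_zpow_eq_one, hx]
    push_cast at h1 ⊢
    omega
  have hsqo : ∀ h : G, ¬ Commute h x → orderOf (h ^ 2) = 2 := fun h hh =>
    orderOf_eq_prime_iff.2 ⟨by rw [← pow_mul]; exact hpow4 h hh, hsq1 h hh⟩
  have hsq : ∀ h k : G, ¬ Commute h x → ¬ Commute k x → h ^ 2 = k ^ 2 := by
    intro h k hh hk
    obtain ⟨n, hn⟩ := mem_zpowers_iff.1
      (hU 2 Nat.prime_two _ (h ^ 2) (hsqo k hk) (by rw [← pow_mul]; exact hpow4 h hh))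
    rw [← hn]
    rcases Int.even_or_odd' n with ⟨l, rfl | rfl⟩
    · exfalso
      apply hsq1 h hh
      rw [← hn, zpow_mul, zpow_ofNat, ← pow_mul, hpow4 k hk, one_zpow]
    · rw [zpow_add, zpow_mul, zpow_ofNat, ← pow_mul, hpow4 k hk, one_zpow, one_mul, zpow_one]
  have hcent : ∀ k g : G, ¬ Commute k x → Commute g x → g * k * g = k := by
    intro k g hk hg
    have hkg : ¬ Commute (k * g) x := fun h => hk (by simpa using h.mul_left hg.inv_left)
    have := hsq (k * g) k hkg hk
    rw [pow_two, pow_two, mul_assoc, mul_right_inj, ← mul_assoc] at this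
    exact this
  push Not at hc
  obtain ⟨y, hy⟩ := hc
  have hab : ∀ g g' : G, Commute g x → Commute g' x → Commute g g' := by
    intro g g' hg hg'
    have h1 := hcent y (g * g') hy (hg.mul_left hg')
    have h2 : g * g' * y * (g' * g) = y := by
      calc g * g' * y * (g' * g) = g * (g' * y * g') * g := by simp only [mul_assoc]
        _ = y := by rw [hcent y g' hy hg', hcent y g hy hg]
    exact mul_left_cancel (h1.trans h2.symm)
  have hexp : ∀ g : G, Commute g x → g ^ 4 = 1 → g ^ 2 = 1 := by
    intro g hg hg4
    have hgx : ∀ u : G, Commute g u → u ^ 3 = 1 → (g * u) ^ 9 = g ∧ (g * u) ^ 4 = u := by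
      intro u hu hu3
      rw [hu.mul_pow, hu.mul_pow, hg4]
      constructor
      · rw [show 9 = 4 * 2 + 1 from rfl, pow_succ g, pow_mul, hg4, one_pow, one_mul,
          show 4 * 2 + 1 = 3 * 3 from rfl, pow_mul, hu3, one_pow, mul_one]
      · rw [pow_succ, hu3, one_mul, one_mul]
    have hx' : x⁻¹ ^ 3 = 1 := by rw [inv_pow, hx3, inv_one]
    obtain ⟨h9, h4⟩ := hgx x hg hx3
    obtain ⟨h9', h4'⟩ := hgx x⁻¹ hg.inv_right hx'
    have hm : ∀ u : G, Commute g u → u ^ 3 = 1 → (g * u) ^ 9 = g → (g * u) ^ 4 = u →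
        g * u⁻¹ ∈ zpowers (g * u) := by
      intro u _ _ h9 h4
      refine mul_mem ?_ (inv_mem ?_)
      · have := pow_mem (mem_zpowers (g * u)) 9
        rwa [h9] at this
      · have := pow_mem (mem_zpowers (g * u)) 4
        rwa [h4] at this
    obtain ⟨t, ht | ht⟩ := hG.exists_semiconjBy_of_mem_zpowers
      (by simpa using hm x⁻¹ hg.inv_right hx' h9' h4') (hm x hg hx3 h9 h4)
    · have ht9 := ht.pow_right 9
      have ht4 := ht.pow_right 4
      rw [h9, h9'] at ht9
      rw [h4, h4'] at ht4
      have htx : ¬ Commute t x := by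
        intro h
        have := ht4.eq
        rw [h.eq, mul_left_inj] at this
        exact hxinv this
      have := hcent t g htx hg
      rw [← ht9.eq, mul_assoc, ← pow_two] at this
      simpa using this
    · have ht9 := ht.pow_right 9
      have ht4 := ht.pow_right 4
      rw [inv_pow, h9, h9'] at ht9
      rw [inv_pow, h4, h4', inv_inv] at ht4
      have h1 := ht9.eq
      rw [(hab t g ht4 hg).eq, mul_left_inj, eq_inv_iff_mul_eq_one, ← pow_two] at h1
      exact h1
  have hC : ∀ g : G, Commute g x →
      ∃ (a : zpowers (y ^ 2)) (b : zpowers x), (a : G) * (b : G) = g := by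
    intro g hg
    have h6 : (g ^ 3) ^ 2 = 1 := hexp (g ^ 3) (hg.pow_left 3) (by rw [← pow_mul]; exact h12 g)
    refine ⟨⟨g ^ 3, hU 2 Nat.prime_two _ _ (hsqo y hy) h6⟩,
      ⟨(g ^ 2)⁻¹, inv_mem (hU 3 Nat.prime_three _ _ hx ?_)⟩, ?_⟩
    · rw [← pow_mul] at h6 ⊢
      exact h6
    · change g ^ 3 * (g ^ 2)⁻¹ = g
      rw [pow_succ', mul_inv_cancel_right]
  refine ⟨le_antisymm ?_ ?_, y ^ 2, hsqo y hy⟩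
  · let f : zpowers (y ^ 2) × zpowers x × Fin 2 → G :=
      fun q => q.1 * q.2.1 * y⁻¹ ^ (q.2.2 : ℕ)
    have hf : Function.Surjective f := by
      intro h
      by_cases hh : Commute h x
      · obtain ⟨a, b, hab⟩ := hC h hh
        exact ⟨(a, b, 0), by simpa [f] using hab⟩
      · have : Commute (h * y) x := by
          have := (hinv h hh).inv_right.mul_left (hinv y hy)
          rwa [inv_inv] at this
        obtain ⟨a, b, hab⟩ := hC _ this
        exact ⟨(a, b, 1), by simp [f, hab]⟩
    have := Nat.card_le_card_of_surjective f hf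
    rw [Nat.card_prod, Nat.card_prod, Nat.card_zpowers, Nat.card_zpowers, hx, hsqo y hy] at this
    simpa using this
  · have hy4 : orderOf y = 2 ^ (1 + 1) :=
      orderOf_eq_prime_pow (by simpa using hsq1 y hy) (hpow4 y hy)
    have h1 : 4 ∣ Nat.card G := by
      have := orderOf_dvd_natCard y
      rwa [hy4] at this
    have h2 : 3 ∣ Nat.card G := hx ▸ orderOf_dvd_natCard x
    exact Nat.le_of_dvd Nat.card_pos
      (Nat.Coprime.mul_dvd_of_dvd_of_dvd (by norm_num : Nat.Coprime 4 3) h1 h2)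

end MagnusProperty

section FrobeniusAction

open Subgroup Finset

variable {H V : Type*} [Group H] [AddCommGroup V] [DistribMulAction H V]

/-- For every nontrivial `h` with `h ^ k = 1`, the norm map `1 + h + ⋯ + h ^ (k - 1)` vanishes on
the module. -/
def NormsVanish (H V : Type*) [Group H] [AddCommGroup V] [DistribMulAction H V] : Prop :=
  ∀ h : H, h ≠ 1 → ∀ k : ℕ, h ^ k = 1 → ∀ v : V, ∑ i ∈ range k, h ^ i • v = 0

theorem eq_zero_of_coprime_nsmul {k p : ℕ} (hkp : k.Coprime p) {v : V} (hk : k • v = 0)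
    (hp : p • v = 0) : v = 0 := by
  rw [← AddMonoid.addOrderOf_eq_one_iff]
  exact Nat.eq_one_of_dvd_coprimes hkp (addOrderOf_dvd_of_nsmul_eq_zero hk)
    (addOrderOf_dvd_of_nsmul_eq_zero hp)

namespace NormsVanish

variable {p : ℕ}

theorem eq_zero_of_smul_eq (hS : NormsVanish H V) (hpV : ∀ v : V, p • v = 0) {h : H} (h1 : h ≠ 1)
    {k : ℕ} (hk : h ^ k = 1) (hkp : k.Coprime p) {v : V} (hv : h • v = v) : v = 0 := by
  refine eq_zero_of_coprime_nsmul hkp ?_ (hpV v)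
  have hpow : ∀ i : ℕ, h ^ i • v = v := by
    intro i
    induction i with
    | zero => simp
    | succ i ih => rw [pow_succ, mul_smul, hv, ih]
  have := hS h h1 k hk v
  simpa only [hpow, sum_const, card_range] using this

theorem sum_smul_eq_zero (hS : NormsVanish H V) (hpV : ∀ v : V, p • v = 0) {M : Subgroup H}
    [Fintype M] (hM : M ≠ ⊥) (hMp : (Nat.card M).Coprime p) (w : V) :
    ∑ m : M, (m : H) • w = 0 := by
  obtain ⟨a, ha⟩ := ne_bot_iff_exists_ne_one.1 hM
  refine hS.eq_zero_of_smul_eq hpV (h := (a : H)) (by simpa using ha) (k := Nat.card M)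
    (by rw [← Subgroup.coe_pow, pow_card_eq_one', Subgroup.coe_one]) hMp ?_
  rw [smul_sum]
  refine Fintype.sum_equiv (Equiv.mulLeft a) _ _ fun m => ?_
  rw [Equiv.coe_mulLeft, Subgroup.coe_mul, mul_smul]

/-- A coprime complement of prime order acting with all elements of the coset `M y` of order `s`
cannot satisfy the norm conditions on a nonzero module. -/
theorem eq_zero_of_forall_mul_pow_eq_one [Finite H] (hS : NormsVanish H V)
    (hpV : ∀ v : V, p • v = 0) {M : Subgroup H} (hM : M ≠ ⊥) (hMp : (Nat.card M).Coprime p)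
    {y : H} (hyM : y ∉ M) (hy : ∀ m ∈ M, y * m * y⁻¹ ∈ M) {s : ℕ} (hs : s.Prime)
    (hys : ∀ m ∈ M, (m * y) ^ s = 1) (v : V) : v = 0 := by
  have := Fintype.ofFinite M
  have hmem : ∀ (m : M) (i : ℕ), (m * y) ^ i * (y ^ i)⁻¹ ∈ M := by
    intro m i
    induction i with
    | zero => simp [one_mem]
    | succ i ih =>
      have : (m * y) ^ (i + 1) * (y ^ (i + 1))⁻¹
          = m * (y * ((m * y) ^ i * (y ^ i)⁻¹) * y⁻¹) := by
        rw [pow_succ' (m * y), pow_succ y]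
        group
      rw [this]
      exact mul_mem m.2 (hy _ ih)
  have hterm : ∀ i ∈ range s, i ≠ 0 → ∑ m : M, ((m : H) * y) ^ i • v = 0 := by
    intro i his hi0
    obtain ⟨k, -, hk⟩ := Nat.exists_mul_mod_eq_one_of_coprime
      (Nat.coprime_of_lt_prime hi0 (mem_range.1 his) hs).symm hs.one_lt
    have hrec : ∀ x : H, x ^ s = 1 → (x ^ i) ^ k = x := by
      intro x hx
      rw [← pow_mul, pow_eq_pow_mod _ hx, hk, pow_one]
    let f : M → M := fun m => ⟨_, hmem m i⟩
    have hf : Function.Injective f := by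
      intro a b hab
      have h1 : ((a : H) * y) ^ i = (b * y) ^ i := mul_right_cancel (congrArg Subtype.val hab)
      have h2 := congrArg (fun z => z ^ k) h1
      simp only [hrec _ (hys _ a.2), hrec _ (hys _ b.2)] at h2
      exact Subtype.ext (mul_right_cancel h2)
    rw [← hS.sum_smul_eq_zero hpV hM hMp (y ^ i • v)]
    refine Fintype.sum_bijective f (Finite.injective_iff_bijective.1 hf) _ _ fun m => ?_
    change _ = ((m * y) ^ i * (y ^ i)⁻¹) • y ^ i • v
    rw [smul_smul, inv_mul_cancel_right]
  have hzero : ∑ i ∈ range s, ∑ m : M, ((m : H) * y) ^ i • v = 0 := by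
    rw [sum_comm]
    refine sum_eq_zero fun m _ => hS _ (fun h => hyM ?_) s (hys m m.2) v
    rw [eq_inv_of_mul_eq_one_right h]
    exact inv_mem m.2
  rw [sum_eq_single_of_mem 0 (mem_range.2 hs.pos) hterm] at hzero
  refine eq_zero_of_coprime_nsmul hMp ?_ (hpV v)
  simpa [← Nat.card_eq_fintype_card] using hzero

end NormsVanish

end FrobeniusAction

section MagnusAction

open Subgroup

variable {H V : Type*} [Group H] [AddCommGroup V] [DistribMulAction H V]

theorem exists_conj_eq_mul_of_forall_commute [Finite H] {M : Subgroup H} [M.Normal] {y : H}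
    (hC : ∀ m ∈ M, Commute m y → m = 1) {m : H} (hm : m ∈ M) :
    ∃ c : H, c * y * c⁻¹ = m * y := by
  let f : M → M := fun c => ⟨c * (y * (c : H)⁻¹ * y⁻¹),
    mul_mem c.2 (Normal.conj_mem ‹_› _ (inv_mem c.2) y)⟩
  have hf : Function.Injective f := by
    intro a b hab
    have h1 : (a : H) * (y * (a : H)⁻¹ * y⁻¹) = b * (y * (b : H)⁻¹ * y⁻¹) :=
      congrArg Subtype.val hab
    have h2 : (a : H) * y * (a : H)⁻¹ = b * y * (b : H)⁻¹ := by
      simpa only [← mul_assoc, mul_left_inj] using h1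
    have h3 := hC ((b : H)⁻¹ * a) (mul_mem (inv_mem b.2) a.2) (by
      change (b : H)⁻¹ * a * y = y * ((b : H)⁻¹ * a)
      rw [mul_inv_eq_iff_eq_mul] at h2
      rw [mul_assoc, h2]
      group)
    exact Subtype.ext (inv_mul_eq_one.1 h3).symm
  obtain ⟨c, hc⟩ := (Finite.injective_iff_surjective.1 hf) ⟨m, hm⟩
  refine ⟨c, ?_⟩
  have : (c : H) * (y * (c : H)⁻¹ * y⁻¹) = m := congrArg Subtype.val hc
  rw [← this]
  group

/-- A faithful module in characteristic `p` on which the group is transitive up to sign forces the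
absence of nontrivial normal `p`-subgroups. -/
theorem ne_of_normal_pow_eq_one [Finite V] [Nontrivial V] {p : ℕ} (hp : p.Prime)
    (hpV : ∀ v : V, p • v = 0) (hfaith : ∀ h : H, (∀ v : V, h • v = v) → h = 1)
    (htr : ∀ v w : V, v ≠ 0 → w ≠ 0 → ∃ h : H, h • v = w ∨ h • v = -w)
    {M : Subgroup H} [hMn : M.Normal] (hM : M ≠ ⊥) {r : ℕ} (hMr : ∀ x ∈ M, x ^ r = 1) : r ≠ p := by
  rintro rfl
  have : Fact r.Prime := ⟨hp⟩
  have hMp : IsPGroup r M := fun x => ⟨1, Subtype.ext (by simpa using hMr x x.2)⟩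
  obtain ⟨v, hv⟩ := exists_ne (0 : V)
  have hcard : r ∣ Nat.card V := by
    have h1 : addOrderOf v = r := addOrderOf_eq_prime (hpV v) hv
    exact h1 ▸ addOrderOf_dvd_natCard v
  obtain ⟨w, hw, hw0⟩ := hMp.exists_fixed_point_of_prime_dvd_card_of_fixed_point (α := V) hcard
    (a := 0) (fun g => smul_zero g)
  apply hM
  rw [eq_bot_iff_forall]
  intro m hm
  refine hfaith m fun u => ?_
  by_cases hu : u = 0
  · rw [hu, smul_zero]
  obtain ⟨h, hh⟩ := htr w u hw0.symm hu
  have h1 : m • h • w = h • w := by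
    have h2 : (h⁻¹ * m * h) • w = w := by
      have := hw ⟨h⁻¹ * m * h, by simpa using hMn.conj_mem m hm h⁻¹⟩
      exact this
    rw [mul_smul, mul_smul, inv_smul_eq_iff] at h2
    exact h2
  rcases hh with hh | hh
  · rwa [hh] at h1
  · rwa [hh, smul_neg, neg_inj] at h1

namespace MagnusProperty

variable {p : ℕ}

/-- Every nontrivial normal subgroup of a finite group with the Magnus property contains a
nontrivial normal subgroup of prime exponent. -/
theorem exists_normal_prime_pow_eq_one [Finite H] (hH : MagnusProperty H) {K : Subgroup H} [K.Normal]
    (hK : K ≠ ⊥) : ∃ (M : Subgroup H) (r : ℕ), M.Normal ∧ M ≠ ⊥ ∧ M ≤ K ∧ r.Prime ∧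
      ∀ x ∈ M, x ^ r = 1 := by
  obtain ⟨M, hMn, hM1, hMK, hmin⟩ := exists_minimal_normal_le hK
  obtain ⟨r, hr, hMr⟩ := hH.exists_prime_pow_eq_one hM1 hmin
  exact ⟨M, r, hMn, hM1, hMK, hr, hMr⟩

theorem uniquePrimeSubgroups_of_normsVanish [Finite H] [Finite V] [Nontrivial V] (hH : MagnusProperty H)
    (hp : p.Prime) (hpV : ∀ v : V, p • v = 0) (hfaith : ∀ h : H, (∀ v : V, h • v = v) → h = 1)
    (hS : NormsVanish H V)
    (htr : ∀ v w : V, v ≠ 0 → w ≠ 0 → ∃ h : H, h • v = w ∨ h • v = -w) :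
    (Nat.card H).Coprime p ∧ UniquePrimeSubgroups H := by
  obtain ⟨v, hv⟩ := exists_ne (0 : V)
  have hcardr : ∀ {M : Subgroup H} {r : ℕ}, r.Prime → (∀ x ∈ M, x ^ r = 1) → r ≠ p →
      IsPGroup r M ∧ (Nat.card M).Coprime p := by
    intro M r hr hMr hrp
    have : Fact r.Prime := ⟨hr⟩
    have hMp : IsPGroup r M := fun x => ⟨1, Subtype.ext (by simpa using hMr x x.2)⟩
    obtain ⟨n, hn⟩ := IsPGroup.iff_card.1 hMp
    exact ⟨hMp, hn ▸ Nat.Coprime.pow_left n ((Nat.coprime_primes hr hp).2 hrp)⟩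
  have hnormal : ∀ {s : ℕ} {y : H}, s.Prime → orderOf y = s → s ≠ p ∧
      ∃ M : Subgroup H, M.Normal ∧ M ≠ ⊥ ∧ ∀ x ∈ M, x ^ s = 1 := by
    intro s y hs hy
    have hy1 : y ≠ 1 := by
      rintro rfl
      exact hs.one_lt.ne (by simpa using hy)
    have hcl : normalClosure {y} ≠ ⊥ := by
      intro h
      exact hy1 (by simpa using
        (h ▸ subset_normalClosure (Set.mem_singleton _) : y ∈ (⊥ : Subgroup H)))
    obtain ⟨M, r, hMn, hM, hMle, hr, hMr⟩ := hH.exists_normal_prime_pow_eq_one hcl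
    have hrp := ne_of_normal_pow_eq_one hp hpV hfaith htr hM hMr
    by_cases hsr : r = s
    · subst hsr
      exact ⟨hrp, M, hMn, hM, hMr⟩
    exfalso
    have hcop : s.Coprime r := (Nat.coprime_primes hs hr).2 (Ne.symm hsr)
    have hC : ∀ m ∈ M, Commute m y → m = 1 := fun m hm hc =>
      hH.eq_one_of_commute_of_coprime hc.symm
        (Nat.Coprime.coprime_dvd_right (orderOf_dvd_of_pow_eq_one (hMr m hm)) (hy.symm ▸ hcop))
        (hMle hm)
    refine hv (hS.eq_zero_of_forall_mul_pow_eq_one hpV hM (hcardr hr hMr hrp).2 (y := y) ?_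
      (fun m hm => hMn.conj_mem m hm y) hs ?_ v)
    · exact fun hyM => hy1 (hC y hyM (Commute.refl y))
    · intro m hm
      obtain ⟨c, hc⟩ := exists_conj_eq_mul_of_forall_commute hC hm
      rw [← hc, conj_pow, ← hy, pow_orderOf_eq_one, mul_one, mul_inv_cancel]
  have hcomm : ∀ {s : ℕ} {a b : H}, s.Prime → orderOf a = s → b ^ s = 1 → Commute a b →
      b ∈ zpowers a := by
    intro s a b hs ha hb hab
    by_contra hba
    have hsa : ∀ m ∈ zpowers a, m ^ s = 1 := by
      intro m hm
      obtain ⟨n, rfl⟩ := mem_zpowers_iff.1 hm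
      rw [← zpow_natCast, zpow_comm, zpow_natCast, ← ha, pow_orderOf_eq_one, one_zpow]
    have hma : ∀ m ∈ zpowers a, Commute m b := by
      intro m hm
      obtain ⟨n, rfl⟩ := mem_zpowers_iff.1 hm
      exact hab.zpow_left n
    have ha1 : zpowers a ≠ ⊥ := by
      intro h
      rw [zpowers_eq_bot] at h
      exact hs.one_lt.ne (by simpa [h] using ha)
    refine hv (hS.eq_zero_of_forall_mul_pow_eq_one hpV ha1
      (hcardr hs hsa (hnormal hs ha).1).2 hba ?_ hs ?_ v)
    · intro m hm
      rwa [← (hma m hm).eq, mul_inv_cancel_right]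
    · intro m hm
      rw [(hma m hm).mul_pow, hb, hsa m hm, one_mul]
  have hcop : (Nat.card H).Coprime p := by
    rw [Nat.coprime_comm, hp.coprime_iff_not_dvd]
    intro hdvd
    have : Fact p.Prime := ⟨hp⟩
    obtain ⟨x, hx⟩ := exists_prime_orderOf_dvd_card' (G := H) p hdvd
    exact (hnormal hp hx).1 rfl
  have hswap : ∀ {s : ℕ} {a b : H}, s.Prime → orderOf a = s → orderOf b = s →
      b ∈ zpowers a → a ∈ zpowers b := by
    intro s a b hs ha hb hba
    have : zpowers b = zpowers a := by
      refine eq_of_le_of_card_ge (zpowers_le.2 hba) ?_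
      rw [Nat.card_zpowers, Nat.card_zpowers, ha, hb]
    exact this ▸ mem_zpowers a
  refine ⟨hcop, fun s hs a b ha hb => ?_⟩
  obtain ⟨hsp, M, hMn, hM, hMs⟩ := hnormal hs ha
  have : Fact s.Prime := ⟨hs⟩
  have hMp := (hcardr hs hMs hsp).1
  have hord : ∀ m ∈ M, m ≠ 1 → orderOf m = s := fun m hm hm1 =>
    orderOf_eq_prime (hMs m hm) hm1
  have : Nontrivial M := (nontrivial_iff_ne_bot M).2 hM
  have hMem : ∀ g : H, orderOf g = s → g ∈ M := by
    intro g hg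
    have hgp : IsPGroup s (zpowers g) := IsPGroup.of_card (n := 1) (by
      rw [Nat.card_zpowers, hg, pow_one])
    let act : MulAction (zpowers g) M := MulAction.compHom M
      ((MulAut.conjNormal (H := M)).comp (zpowers g).subtype)
    have hdvd : s ∣ Nat.card M := by
      obtain ⟨m, hm⟩ := exists_ne (1 : M)
      have := hord m m.2 (by simpa using hm)
      rw [← this, orderOf_coe]
      exact orderOf_dvd_natCard m
    obtain ⟨m, hm, hm1⟩ := hgp.exists_fixed_point_of_prime_dvd_card_of_fixed_point (α := M) hdvd
      (a := 1) (fun c => map_one (MulAut.conjNormal (c : H)))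
    have h1 : g * m * g⁻¹ = m := by
      have h2 : MulAut.conjNormal g m = m := hm ⟨g, mem_zpowers g⟩
      have := MulAut.conjNormal_apply g m
      rw [h2] at this
      exact this.symm
    have h2 : g ∈ zpowers (m : H) := by
      refine hcomm hs (hord m m.2 (by simpa using hm1.symm)) (by rw [← hg, pow_orderOf_eq_one]) ?_
      exact (mul_inv_eq_iff_eq_mul.1 h1).symm
    exact zpowers_le.2 m.2 h2
  have := hMp.center_nontrivial
  obtain ⟨⟨c, hc⟩, hc1⟩ := exists_ne (1 : center M)
  have hco : orderOf (c : H) = s := hord c c.2 (by simpa using hc1)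
  have hcen : ∀ g : H, orderOf g = s → g ∈ zpowers (c : H) := by
    intro g hg
    refine hcomm hs hco (by rw [← hg, pow_orderOf_eq_one]) ?_
    exact (congrArg Subtype.val (mem_center_iff.1 hc ⟨g, hMem g hg⟩)).symm
  by_cases hb1 : b = 1
  · exact hb1 ▸ one_mem _
  · exact zpowers_le.2 (hswap hs hco ha (hcen a ha)) (hcen b (orderOf_eq_prime hb hb1))

/-- A finite group with the Magnus property acting faithfully, transitively up to sign and with
vanishing norms on a nontrivial elementary abelian group is nilpotent. -/
theorem isNilpotent_of_normsVanish [Finite H] [Finite V] [Nontrivial V] (hH : MagnusProperty H)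
    (hp : p.Prime) (hpV : ∀ v : V, p • v = 0) (hfaith : ∀ h : H, (∀ v : V, h • v = v) → h = 1)
    (hS : NormsVanish H V)
    (htr : ∀ v w : V, v ≠ 0 → w ≠ 0 → ∃ h : H, h • v = w ∨ h • v = -w) :
    Group.IsNilpotent H := by
  obtain ⟨hcop, hU⟩ := hH.uniquePrimeSubgroups_of_normsVanish hp hpV hfaith hS htr
  rcases hH.isNilpotent_or_card_eq_twelve hU with h | ⟨hcard, z, hz⟩
  · exact h
  obtain ⟨v, hv⟩ := exists_ne (0 : V)
  have hneg : ∀ w : V, z • w = -w := by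
    intro w
    have h1 : z ≠ 1 := by
      rintro rfl
      simp at hz
    have := hS z h1 2 (hz ▸ pow_orderOf_eq_one z) w
    rw [Finset.sum_range_succ, Finset.sum_range_one, pow_zero, one_smul, pow_one] at this
    exact eq_neg_of_add_eq_zero_right this
  let f : Option H → V := fun o => o.elim 0 fun h => h • v
  have hf : Function.Bijective f := by
    refine ⟨?_, fun w => ?_⟩
    · rintro (_ | a) (_ | b) hab
      · rfl
      · exact absurd hab.symm (smul_ne_zero_iff_ne b |>.2 hv)
      · exact absurd hab (smul_ne_zero_iff_ne a |>.2 hv)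
      · have h1 : a • v = b • v := hab
        by_contra hne
        refine hv (hS.eq_zero_of_smul_eq hpV (h := b⁻¹ * a) (fun h => hne ?_)
          pow_card_eq_one' hcop ?_)
        · rw [inv_mul_eq_one.1 h]
        · rw [mul_smul, h1, inv_smul_smul]
    · by_cases hw : w = 0
      · exact ⟨none, hw.symm⟩
      obtain ⟨h, hh | hh⟩ := htr v w hv hw
      · exact ⟨some h, hh⟩
      · refine ⟨some (z * h), ?_⟩
        change (z * h) • v = w
        rw [mul_smul, hh, hneg, neg_neg]
  have hV : Nat.card V = 13 := by
    rw [← Nat.card_congr (Equiv.ofBijective f hf), Finite.card_option, hcard]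
  have : Fact (Nat.Prime 13) := ⟨by norm_num⟩
  have : IsAddCyclic V := isAddCyclic_of_prime_card hV
  have hcomm : ∀ a b : H, a * b = b * a := by
    intro a b
    rw [← inv_mul_eq_one]
    refine hfaith _ fun u => ?_
    obtain ⟨m, hm⟩ := (DistribSMul.toAddMonoidHom V a).map_addCyclic
    rw [mul_smul, inv_smul_eq_iff, mul_smul, mul_smul]
    have hm' : ∀ w : V, a • w = m • w := hm
    rw [hm', hm']
    exact map_zsmul (DistribSMul.toAddMonoidHom V b) m u
  let : CommGroup H := { (inferInstance : Group H) with mul_comm := hcomm }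
  exact CommGroup.isNilpotent

end MagnusProperty

end MagnusAction

section Reduction

open Subgroup

variable {G : Type*} [Group G]

theorem isNilpotent_of_injective {H : Type*} [Group H] [Group.IsNilpotent H] (f : G →* H)
    (hf : Function.Injective f) : Group.IsNilpotent G :=
  Subgroup.isNilpotent_of_ker_le_center f (by rw [(f.ker_eq_bot_iff).2 hf]; exact bot_le)

/-- A minimal normal subgroup which is a nontrivial `p`-group is abelian. -/
theorem mul_comm_of_isPGroup_of_minimal [Finite G] {p : ℕ} [Fact p.Prime] {N : Subgroup G}
    [N.Normal] (hN : N ≠ ⊥) (hNp : IsPGroup p N)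
    (hmin : ∀ L : Subgroup G, L.Normal → L ≠ ⊥ → L ≤ N → L = N) (a b : N) : a * b = b * a := by
  have : Nontrivial N := (nontrivial_iff_ne_bot N).2 hN
  have := hNp.center_nontrivial
  have h1 : (center N).map N.subtype = N := by
    refine hmin _ inferInstance ?_ (map_subtype_le _)
    rw [Ne, map_eq_bot_iff_of_injective _ N.subtype_injective]
    exact (nontrivial_iff_ne_bot _).1 this
  have h2 : (b : G) ∈ (center N).map N.subtype := h1.symm ▸ b.2
  obtain ⟨c, hc, hcb⟩ := h2
  obtain rfl : c = b := Subtype.ext hcb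
  exact mem_center_iff.1 hc a

/-- A complement of a unique minimal normal subgroup, abelian of prime exponent, in a finite group
with the Magnus property is nilpotent. -/
theorem MagnusProperty.isNilpotent_of_isCompl [Finite G] (hG : MagnusProperty G) {p : ℕ}
    (hp : p.Prime) {N L : Subgroup G} [hNn : N.Normal] (hN : N ≠ ⊥) (hNp : ∀ x ∈ N, x ^ p = 1)
    (hab : ∀ a b : N, a * b = b * a) (hmono : ∀ X : Subgroup G, X.Normal → X ≠ ⊥ → N ≤ X)
    (hL : IsCompl L N) : Group.IsNilpotent L := by
  have hcl : ∀ x : G, x ≠ 1 → N ≤ normalClosure {x} := by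
    intro x hx
    refine hmono _ inferInstance fun h => hx ?_
    simpa using (h ▸ subset_normalClosure (Set.mem_singleton _) : x ∈ (⊥ : Subgroup G))
  have hinf : ∀ x : G, x ∈ L → x ∈ N → x = 1 := fun x hxL hxN =>
    disjoint_def.1 hL.disjoint hxL hxN
  have hdec : ∀ g : G, ∃ l ∈ L, ∃ n ∈ N, l * n = g := fun g =>
    mem_sup_of_normal_right.1 (hL.sup_eq_top ▸ mem_top g)
  have hLMP : MagnusProperty L := by
    refine (hG.quotient N).of_mulEquiv
      (MulEquiv.ofBijective ((QuotientGroup.mk' N).comp L.subtype) ⟨?_, ?_⟩).symm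
    · rw [injective_iff_map_eq_one]
      exact fun x hx => Subtype.ext (hinf x x.2 ((QuotientGroup.eq_one_iff (x : G)).1 hx))
    · intro q
      obtain ⟨g, rfl⟩ := QuotientGroup.mk_surjective q
      obtain ⟨l, hl, n, hn, rfl⟩ := hdec g
      exact ⟨⟨l, hl⟩, QuotientGroup.eq.2 (by simpa using hn)⟩
  let : CommGroup N := { (inferInstance : Group N) with mul_comm := hab }
  let : DistribMulAction L (Additive N) :=
    { smul := fun l v => Additive.ofMul (MulAut.conjNormal (l : G) v.toMul)
      one_smul := fun v => by
        change Additive.ofMul (MulAut.conjNormal ((1 : L) : G) v.toMul) = v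
        simp
      mul_smul := fun a b v => by
        change Additive.ofMul (MulAut.conjNormal ((a * b : L) : G) v.toMul) = Additive.ofMul
          (MulAut.conjNormal (a : G) (MulAut.conjNormal (b : G) v.toMul))
        simp
      smul_zero := fun l => map_one (MulAut.conjNormal (l : G))
      smul_add := fun l v w => map_mul (MulAut.conjNormal (l : G)) v.toMul w.toMul }
  have hsmul : ∀ (l : L) (v : Additive N), ((l • v).toMul : G) = l * v.toMul * (l : G)⁻¹ :=
    fun l v => MulAut.conjNormal_apply (l : G) v.toMul
  have hext : ∀ v w : Additive N, (v.toMul : G) = w.toMul → v = w := fun v w h => Subtype.ext h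
  have hne : ∀ v : Additive N, v ≠ 0 → (v.toMul : G) ≠ 1 := fun v hv h => hv (hext v 0 h)
  have : Nontrivial N := (nontrivial_iff_ne_bot N).2 hN
  refine hLMP.isNilpotent_of_normsVanish (V := Additive N) hp ?_ ?_ ?_ ?_
  · exact fun v => hext _ _ (hNp v.toMul v.toMul.2)
  · intro h hh
    by_contra h1
    have hc : (h : G) ∈ L ⊓ centralizer (N : Set G) := by
      refine ⟨h.2, mem_centralizer_iff.2 fun n hn => ?_⟩
      have := hsmul h (Additive.ofMul ⟨n, hn⟩)
      rw [hh] at this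
      exact eq_mul_inv_iff_mul_eq.1 this
    have hnormal : (L ⊓ centralizer (N : Set G)).Normal := by
      refine ⟨fun c hc g => ?_⟩
      refine ⟨?_, Normal.conj_mem inferInstance c hc.2 g⟩
      obtain ⟨l, hl, n, hn, rfl⟩ := hdec g
      have : l * n * c * (l * n)⁻¹ = l * c * l⁻¹ := by
        rw [mul_assoc l n c, mem_centralizer_iff.1 hc.2 n hn]
        group
      change l * n * c * (l * n)⁻¹ ∈ L
      rw [this]
      exact mul_mem (mul_mem hl hc.1) (inv_mem hl)
    have hle := hmono _ hnormal fun hbot => h1 (Subtype.ext (by simpa [hbot] using hc))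
    refine hN (eq_bot_iff_forall _ |>.2 fun n hn => hinf n (hle hn).1 hn)
  · intro h h1 k hk v
    have hsum : ∀ k : ℕ, ((∑ i ∈ Finset.range k, h ^ i • v).toMul : G)
        = (v.toMul * h) ^ k * ((h : G) ^ k)⁻¹ := by
      intro k
      induction k with
      | zero => simp
      | succ k ih =>
        rw [Finset.sum_range_succ, toMul_add, Subgroup.coe_mul, ih, hsmul, Subgroup.coe_pow,
          pow_succ (_ * _), pow_succ (h : G)]
        group
    have hh1 : (h : G) ≠ 1 := fun h' => h1 (Subtype.ext h')
    have hvh : (v.toMul * h : G) ≠ 1 := by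
      intro h'
      refine hh1 (hinf h h.2 ?_)
      rw [eq_inv_of_mul_eq_one_right h']
      exact inv_mem v.toMul.2
    have heq : normalClosure {(v.toMul * h : G)} = normalClosure {(h : G)} := by
      apply le_antisymm <;> refine normalClosure_le_normal (Set.singleton_subset_iff.2 ?_)
      · exact mul_mem (hcl h hh1 v.toMul.2) (subset_normalClosure (Set.mem_singleton _))
      · exact (mul_mem_cancel_left (hcl _ hvh v.toMul.2)).1
          (subset_normalClosure (Set.mem_singleton _))
    have hk' : (h : G) ^ k = 1 := by rw [← Subgroup.coe_pow, hk, Subgroup.coe_one]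
    refine hext _ _ ((hsum k).trans ?_)
    rw [hk', orderOf_dvd_iff_pow_eq_one.1 (hG.orderOf_eq heq ▸ orderOf_dvd_of_pow_eq_one hk')]
    simp
  · intro v w hv hw
    have hclN : ∀ v : Additive N, v ≠ 0 → normalClosure {(v.toMul : G)} = N := fun v hv =>
      le_antisymm (normalClosure_le_normal (Set.singleton_subset_iff.2 v.toMul.2))
        (hcl _ (hne v hv))
    have hconj : ∀ y : G, IsConj (v.toMul : G) y → ∃ l : L, (l : G) * v.toMul * (l : G)⁻¹ = y := by
      intro y hy
      obtain ⟨g, rfl⟩ := isConj_iff.1 hy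
      obtain ⟨l, hl, n, hn, rfl⟩ := hdec g
      refine ⟨⟨l, hl⟩, ?_⟩
      have := congrArg Subtype.val (hab ⟨n, hn⟩ v.toMul)
      change n * v.toMul = v.toMul * n at this
      rw [mul_assoc l n, this]
      group
    rcases hG _ _ ((hclN v hv).trans (hclN w hw).symm) with h | h
    · obtain ⟨l, hl⟩ := hconj _ h
      exact ⟨l, Or.inl (hext _ _ ((hsmul l v).trans hl))⟩
    · obtain ⟨l, hl⟩ := hconj _ h
      exact ⟨l, Or.inr (hext _ _ ((hsmul l v).trans hl))⟩

end Reduction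

section FittingHeight

open Subgroup

variable {G : Type*} [Group G]

theorem Subgroup.card_quotient_lt_of_ne_bot [Finite G] {N : Subgroup G} (hN : N ≠ ⊥) :
    Nat.card (G ⧸ N) < Nat.card G := by
  rw [card_eq_card_quotient_mul_card_subgroup N]
  exact lt_mul_of_one_lt_right Nat.card_pos ((one_lt_card_iff_ne_bot N).2 hN)

/-- A group embedding in a product of two nilpotent-by-nilpotent groups is nilpotent-by-nilpotent. -/
theorem exists_isNilpotent_of_ker_inf_ker_eq_bot {A B : Type*} [Group A] [Group B]
    (f : G →* A) (g : G →* B) (hfg : f.ker ⊓ g.ker = ⊥)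
    (hA : ∃ (K : Subgroup A) (_ : K.Normal), Group.IsNilpotent K ∧ Group.IsNilpotent (A ⧸ K))
    (hB : ∃ (K : Subgroup B) (_ : K.Normal), Group.IsNilpotent K ∧ Group.IsNilpotent (B ⧸ K)) :
    ∃ (K : Subgroup G) (_ : K.Normal), Group.IsNilpotent K ∧ Group.IsNilpotent (G ⧸ K) := by
  obtain ⟨K₁, _, _, _⟩ := hA
  obtain ⟨K₂, _, _, _⟩ := hB
  let φ : G →* (A ⧸ K₁) × (B ⧸ K₂) :=
    ((QuotientGroup.mk' K₁).comp f).prod ((QuotientGroup.mk' K₂).comp g)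
  have h₁ : φ.ker ≤ K₁.comap f := fun x hx =>
    (QuotientGroup.eq_one_iff (f x)).1 (congrArg Prod.fst (MonoidHom.mem_ker.1 hx))
  have h₂ : φ.ker ≤ K₂.comap g := fun x hx =>
    (QuotientGroup.eq_one_iff (g x)).1 (congrArg Prod.snd (MonoidHom.mem_ker.1 hx))
  refine ⟨φ.ker, inferInstance, ?_,
    isNilpotent_of_injective (QuotientGroup.kerLift φ) (QuotientGroup.kerLift_injective φ)⟩
  let ψ : φ.ker →* K₁ × K₂ :=
    ((f.comp φ.ker.subtype).codRestrict K₁ fun x => h₁ x.2).prod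
      ((g.comp φ.ker.subtype).codRestrict K₂ fun x => h₂ x.2)
  refine isNilpotent_of_injective ψ ((injective_iff_map_eq_one ψ).2 fun x hx => ?_)
  have hx' : (x : G) ∈ f.ker ⊓ g.ker :=
    ⟨congrArg Subtype.val (congrArg Prod.fst hx), congrArg Subtype.val (congrArg Prod.snd hx)⟩
  rw [hfg] at hx'
  exact Subtype.ext hx'

/-- If the preimage `K` in `G` of a normal nilpotent subgroup of `G ⧸ N` is not nilpotent, then
some proper subgroup supplements `N`. -/
theorem exists_sup_eq_top_of_not_isNilpotent [Finite G] {N : Subgroup G} [N.Normal]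
    {K : Subgroup (G ⧸ N)} [K.Normal] [Group.IsNilpotent K]
    (hK : ¬ Group.IsNilpotent (K.comap (QuotientGroup.mk' N))) :
    ∃ L : Subgroup G, L ⊔ N = ⊤ ∧ ¬ N ≤ L := by
  set K' := K.comap (QuotientGroup.mk' N) with hK'
  rw [Group.isNilpotent_of_finite_tfae.out 0 3 rfl rfl] at hK
  push Not at hK
  obtain ⟨q, _, Q, hQ⟩ := hK
  let f : K' →* K := (QuotientGroup.mk' N).subgroupComap K
  have hf : Function.Surjective f :=
    MonoidHom.subgroupComap_surjective_of_surjective _ _ (QuotientGroup.mk'_surjective N)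
  let S : Sylow q K := Q.mapSurjective hf
  have : (S : Subgroup K).Characteristic := S.characteristic_of_normal inferInstance
  let R : Subgroup G := ((S : Subgroup K).map K.subtype).comap (QuotientGroup.mk' N)
  let Q' : Subgroup G := (Q : Subgroup K').map K'.subtype
  have hQR : Q' ≤ R := by
    rintro _ ⟨x, hx, rfl⟩
    exact ⟨f x, ⟨x, hx, rfl⟩, rfl⟩
  have hRK : R ≤ K' := by
    intro x hx
    obtain ⟨y, -, hy⟩ := hx
    change QuotientGroup.mk' N x ∈ K
    rw [← hy]
    exact y.2
  have hQQ : Q'.subgroupOf K' = Q := comap_map_eq_self_of_injective K'.subtype_injective _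
  have hindex : ¬ q ∣ (Q'.subgroupOf R).index := by
    intro hdvd
    refine Q.not_dvd_index ?_
    rw [← hQQ]
    exact hdvd.trans (Dvd.intro _ (relIndex_mul_relIndex Q' R K' hQR hRK))
  have hQp : IsPGroup q (Q'.subgroupOf R) :=
    (Q.isPGroup'.map K'.subtype).comap_of_injective R.subtype R.subtype_injective
  have hfr := Sylow.normalizer_sup_eq_top (hQp.toSylow hindex)
  have hmap : (Q'.subgroupOf R).map R.subtype = Q' := map_subgroupOf_eq_of_le hQR
  change normalizer ((Q'.subgroupOf R).map R.subtype : Set G) ⊔ R = ⊤ at hfr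
  rw [hmap] at hfr
  have hR : R ≤ normalizer (Q' : Set G) ⊔ N := by
    rintro x ⟨_, ⟨y, hy, rfl⟩, hyx⟩
    have h1 : (y : G)⁻¹ * x ∈ N := QuotientGroup.eq.1 hyx
    rw [← mul_inv_cancel_left (y : G) x]
    exact mul_mem (mem_sup_left (le_normalizer ⟨y, hy, rfl⟩)) (mem_sup_right h1)
  have htop : normalizer (Q' : Set G) ⊔ N = ⊤ := top_le_iff.1 (hfr ▸ sup_le le_sup_left hR)
  refine ⟨_, htop, fun hle => hQ ?_⟩
  rw [sup_eq_left.2 hle] at htop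
  have : Q'.Normal := normalizer_eq_top_iff.1 htop
  rw [← hQQ]
  infer_instance

namespace MagnusProperty

/-- A finite group with the Magnus property whose nontrivial normal subgroups all contain `N` is
nilpotent-by-nilpotent if `G ⧸ N` is. -/
theorem exists_isNilpotent_of_forall_le [Finite G] (hG : MagnusProperty G) {N : Subgroup G}
    [hNn : N.Normal] (hN : N ≠ ⊥) (hmono : ∀ X : Subgroup G, X.Normal → X ≠ ⊥ → N ≤ X)
    (hGN : ∃ (K : Subgroup (G ⧸ N)) (_ : K.Normal),
      Group.IsNilpotent K ∧ Group.IsNilpotent ((G ⧸ N) ⧸ K)) :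
    ∃ (K : Subgroup G) (_ : K.Normal), Group.IsNilpotent K ∧ Group.IsNilpotent (G ⧸ K) := by
  have hmin : ∀ L : Subgroup G, L.Normal → L ≠ ⊥ → L ≤ N → L = N := fun L h1 h2 h3 =>
    le_antisymm h3 (hmono L h1 h2)
  obtain ⟨p, hp, hNp⟩ := hG.exists_prime_pow_eq_one hN hmin
  have : Fact p.Prime := ⟨hp⟩
  have hNpg : IsPGroup p N := fun x => ⟨1, Subtype.ext (by simpa using hNp x x.2)⟩
  have hab := mul_comm_of_isPGroup_of_minimal hN hNpg hmin
  obtain ⟨K, _, _, _⟩ := hGN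
  by_cases hK : Group.IsNilpotent (K.comap (QuotientGroup.mk' N))
  · refine ⟨K.comap (QuotientGroup.mk' N), inferInstance, hK, ?_⟩
    refine isNilpotent_of_injective
      (QuotientGroup.map _ K (QuotientGroup.mk' N) le_rfl) ((injective_iff_map_eq_one _).2 ?_)
    intro x hx
    obtain ⟨x, rfl⟩ := QuotientGroup.mk_surjective x
    have hx' : ((QuotientGroup.mk' N x : G ⧸ N) : (G ⧸ N) ⧸ K) = 1 := hx
    have hxK : QuotientGroup.mk' N x ∈ K := (QuotientGroup.eq_one_iff _).1 hx'
    exact (QuotientGroup.eq_one_iff x).2 hxK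
  obtain ⟨L, hLN, hNL⟩ := exists_sup_eq_top_of_not_isNilpotent hK
  have hdec : ∀ g : G, ∃ l ∈ L, ∃ n ∈ N, l * n = g := fun g =>
    mem_sup_of_normal_right.1 (hLN ▸ mem_top g)
  have hnormal : (L ⊓ N).Normal := by
    refine ⟨fun x hx g => ⟨?_, hNn.conj_mem x hx.2 g⟩⟩
    obtain ⟨l, hl, n, hn, rfl⟩ := hdec g
    have h1 : n * x = x * n := congrArg Subtype.val (hab ⟨n, hn⟩ ⟨x, hx.2⟩)
    have h2 : l * n * x * (l * n)⁻¹ = l * x * l⁻¹ := by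
      rw [mul_assoc l n x, h1]
      group
    change l * n * x * (l * n)⁻¹ ∈ L
    rw [h2]
    exact mul_mem (mul_mem hl hx.1) (inv_mem hl)
  have hinf : L ⊓ N = ⊥ := by
    by_contra h
    exact hNL ((hmono _ hnormal h).trans inf_le_left)
  have := hG.isNilpotent_of_isCompl hp hN hNp hab hmono
    ⟨disjoint_iff.2 hinf, codisjoint_iff.2 hLN⟩
  refine ⟨N, hNn, hNpg.isNilpotent, Group.nilpotent_of_surjective
    ((QuotientGroup.mk' N).comp L.subtype) fun x => ?_⟩
  obtain ⟨g, rfl⟩ := QuotientGroup.mk_surjective x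
  obtain ⟨l, hl, n, hn, rfl⟩ := hdec g
  exact ⟨⟨l, hl⟩, QuotientGroup.eq.2 (by simpa using hn)⟩

universe u

theorem exists_isNilpotent_of_card (n : ℕ) : ∀ (G : Type u) [Group G] [Finite G],
    MagnusProperty G → Nat.card G = n →
    ∃ (K : Subgroup G) (_ : K.Normal), Group.IsNilpotent K ∧ Group.IsNilpotent (G ⧸ K) := by
  induction n using Nat.strong_induction_on with
  | h n ih =>
    intro G _ _ hG hn
    rcases subsingleton_or_nontrivial G with _ | _
    · exact ⟨⊥, inferInstance, inferInstance, inferInstance⟩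
    have hq : ∀ (N : Subgroup G) [N.Normal], N ≠ ⊥ → ∃ (K : Subgroup (G ⧸ N)) (_ : K.Normal),
        Group.IsNilpotent K ∧ Group.IsNilpotent ((G ⧸ N) ⧸ K) := fun N _ hN =>
      ih _ (hn ▸ card_quotient_lt_of_ne_bot hN) (G ⧸ N) (hG.quotient N) rfl
    obtain ⟨N, hNn, hN, -, hmin⟩ := exists_minimal_normal_le (G := G) top_ne_bot
    by_cases hmono : ∀ X : Subgroup G, X.Normal → X ≠ ⊥ → N ≤ X
    · exact hG.exists_isNilpotent_of_forall_le hN hmono (hq N hN)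
    push Not at hmono
    obtain ⟨X, hXn, hX, hNX⟩ := hmono
    refine exists_isNilpotent_of_ker_inf_ker_eq_bot (QuotientGroup.mk' N) (QuotientGroup.mk' X) ?_
      (hq N hN) (hq X hX)
    rw [QuotientGroup.ker_mk', QuotientGroup.ker_mk']
    by_contra h
    exact hNX (inf_eq_left.1 (hmin _ inferInstance h inf_le_left))

end MagnusProperty

end FittingHeight

theorem finite_MP_fittingHeight_le_two (G : Type*) [Group G] [Finite G]
    (hG : MagnusProperty G) :
    ∃ (N : Subgroup G) (hN : N.Normal),
      Group.IsNilpotent N ∧ (haveI := hN; Group.IsNilpotent (G ⧸ N)) :=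
  MagnusProperty.exists_isNilpotent_of_card _ G hG rfl
end

section
/- If G is a nontrivial finite group with the Magnus Property and p is a prime dividing the order of G, then p ∈ {2, 3, 5, 7}. -/
section MinimalNormal

variable {G : Type*} [Group G]

theorem MagnusProperty.quotient_s5 [Finite G] (hG : MagnusProperty G) (N : Subgroup G) [N.Normal] :
    MagnusProperty (G ⧸ N) := by
  intro x y hxy
  let π := QuotientGroup.mk' N
  have hπ : Function.Surjective π := QuotientGroup.mk'_surjective N
  let S : Set (Subgroup G) :=
    {K | K.Normal ∧ K.map π = Subgroup.normalClosure {x}}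
  have hS : S.Nonempty := ⟨(Subgroup.normalClosure {x}).comap π,
    Subgroup.Normal.comap Subgroup.normalClosure_normal π,
    Subgroup.map_comap_eq_self_of_surjective hπ _⟩
  obtain ⟨K, hK⟩ := S.toFinite.exists_minimal hS
  have hlift : ∀ t : G ⧸ N, Subgroup.normalClosure {t} = Subgroup.normalClosure {x} →
      ∃ k : G, π k = t ∧ Subgroup.normalClosure {k} = K := by
    intro t ht
    have htK : t ∈ K.map π := by
      rw [hK.prop.2, ← ht]
      exact Subgroup.subset_normalClosure rfl
    obtain ⟨k, hk, rfl⟩ := htK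
    have hle : Subgroup.normalClosure {k} ≤ K := by
      have := hK.prop.1
      exact Subgroup.normalClosure_le_normal (by simpa using hk)
    refine ⟨k, rfl, le_antisymm hle (hK.le_of_le ⟨Subgroup.normalClosure_normal, ?_⟩ hle)⟩
    rw [Subgroup.map_normalClosure _ _ hπ, Set.image_singleton, ht]
  obtain ⟨a, rfl, ha⟩ := hlift x rfl
  obtain ⟨b, rfl, hb⟩ := hlift y hxy.symm
  rcases hG a b (ha.trans hb.symm) with h | h
  · exact Or.inl (π.map_isConj h)
  · exact Or.inr (by simpa using π.map_isConj h)

/-- A minimal nontrivial normal subgroup. -/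
structure Subgroup.IsMinimalNormal (N : Subgroup G) : Prop where
  normal : N.Normal
  ne_bot : N ≠ ⊥
  eq_of_le : ∀ M : Subgroup G, M.Normal → M ≠ ⊥ → M ≤ N → M = N

theorem Subgroup.exists_isMinimalNormal_le [Finite G] (D : Subgroup G) (hD : D.Normal)
    (hbot : D ≠ ⊥) : ∃ N : Subgroup G, N.IsMinimalNormal ∧ N ≤ D := by
  let S : Set (Subgroup G) := {K | K.Normal ∧ K ≠ ⊥ ∧ K ≤ D}
  obtain ⟨N, hN⟩ := S.toFinite.exists_minimal ⟨D, hD, hbot, le_rfl⟩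
  exact ⟨N, ⟨hN.prop.1, hN.prop.2.1, fun M h1 h2 h3 => le_antisymm h3
    (hN.le_of_le ⟨h1, h2, h3.trans hN.prop.2.2⟩ h3)⟩, hN.prop.2.2⟩

theorem Subgroup.IsMinimalNormal.normalClosure_eq {N : Subgroup G} (hN : N.IsMinimalNormal)
    {x : G} (hx : x ∈ N) (hx1 : x ≠ 1) : Subgroup.normalClosure {x} = N := by
  have := hN.normal
  refine hN.eq_of_le _ Subgroup.normalClosure_normal (fun h => hx1 ?_)
    (Subgroup.normalClosure_le_normal (by simpa using hx))
  have : x ∈ Subgroup.normalClosure {x} := Subgroup.subset_normalClosure rfl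
  rw [h] at this
  simpa using this

theorem Subgroup.IsMinimalNormal.isConj {N : Subgroup G} (hN : N.IsMinimalNormal)
    (hG : MagnusProperty G) {x y : G} (hx : x ∈ N) (hx1 : x ≠ 1) (hy : y ∈ N) (hy1 : y ≠ 1) :
    IsConj x y ∨ IsConj x y⁻¹ :=
  hG x y ((hN.normalClosure_eq hx hx1).trans (hN.normalClosure_eq hy hy1).symm)

theorem IsConj.orderOf_eq_orderOf {x y : G} (h : IsConj x y) : orderOf x = orderOf y := by
  obtain ⟨c, rfl⟩ := isConj_iff.1 h
  exact ((MulAut.conj c).orderOf_eq x).symm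

theorem Subgroup.IsMinimalNormal.pow_eq_one [Finite G] {N : Subgroup G} (hN : N.IsMinimalNormal)
    (hG : MagnusProperty G) {q : ℕ} (hq : q.Prime) (hdvd : q ∣ Nat.card N) {x : G} (hx : x ∈ N) :
    x ^ q = 1 := by
  have := Fact.mk hq
  by_cases hx1 : x = 1
  · simp [hx1]
  obtain ⟨z, hz⟩ := exists_prime_orderOf_dvd_card' q hdvd
  have hzo : orderOf (z : G) = q := by rw [Subgroup.orderOf_coe, hz]
  have hz1 : (z : G) ≠ 1 := fun h => hq.one_lt.ne' (by rw [← hzo, h, orderOf_one])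
  have : orderOf x = q := by
    rcases hN.isConj hG hx hx1 z.2 hz1 with h | h
    · rw [h.orderOf_eq_orderOf, hzo]
    · rw [h.orderOf_eq_orderOf, orderOf_inv, hzo]
  rw [← this, pow_orderOf_eq_one]

theorem Subgroup.IsMinimalNormal.exists_prime [Finite G] {N : Subgroup G}
    (hN : N.IsMinimalNormal) : ∃ q : ℕ, q.Prime ∧ q ∣ Nat.card N :=
  Nat.exists_prime_and_dvd (fun h => hN.ne_bot (Subgroup.card_eq_one.1 h))

theorem Subgroup.IsMinimalNormal.mul_comm [Finite G] {N : Subgroup G} (hN : N.IsMinimalNormal)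
    (hG : MagnusProperty G) {x y : G} (hx : x ∈ N) (hy : y ∈ N) : x * y = y * x := by
  obtain ⟨q, hq, hdvd⟩ := hN.exists_prime
  have := Fact.mk hq
  have := hN.normal
  have hp : IsPGroup q N := fun g => ⟨1, by
    ext; simpa using hN.pow_eq_one hG hq hdvd g.2⟩
  have : Nontrivial N := (Subgroup.nontrivial_iff_ne_bot N).2 hN.ne_bot
  have hc : Nontrivial (Subgroup.center N) := hp.center_nontrivial
  have hmap : (Subgroup.center N).map N.subtype = N := by
    refine hN.eq_of_le _ inferInstance ?_ (Subgroup.map_subtype_le _)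
    rw [Ne, Subgroup.map_eq_bot_iff_of_injective _ N.subtype_injective]
    exact (Subgroup.nontrivial_iff_ne_bot _).1 hc
  rw [← hmap] at hx
  obtain ⟨⟨x, hx'⟩, hxc, rfl⟩ := hx
  exact (congrArg Subtype.val (Subgroup.mem_center_iff.1 hxc ⟨y, hy⟩)).symm

end MinimalNormal

theorem Nat.le_two_mul_totient_sq (m : ℕ) : m ≤ 2 * m.totient ^ 2 := by
  suffices h : m ≤ (if m % 4 = 2 then 2 else 1) * m.totient ^ 2 by
    split_ifs at h <;> omega
  induction m using Nat.recOnPosPrimePosCoprime with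
  | zero => simp
  | one => simp
  | prime_pow p n hp hn =>
    obtain ⟨k, rfl⟩ : ∃ k, n = k + 1 := ⟨n - 1, by omega⟩
    rw [Nat.totient_prime_pow_succ hp]
    have hk : p ^ k ≤ p ^ k * p ^ k := Nat.le_mul_self _
    rcases hp.two_le.eq_or_lt with rfl | h3
    · rcases k with _ | k
      · simp
      · have hmod : ¬ 2 ^ (k + 1 + 1) % 4 = 2 := by
          rw [pow_succ, pow_succ]; omega
        rw [if_neg hmod]
        have : 1 ≤ 2 ^ k := Nat.one_le_two_pow
        simp only [pow_succ]
        nlinarith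
    · obtain ⟨r, rfl⟩ : ∃ r, p = r + 3 := ⟨p - 3, by omega⟩
      calc (r + 3) ^ (k + 1) = (r + 3) ^ k * (r + 3) := pow_succ _ _
        _ ≤ ((r + 3) ^ k * (r + 3) ^ k) * ((r + 2) * (r + 2)) :=
            Nat.mul_le_mul hk (by nlinarith)
        _ = 1 * ((r + 3) ^ k * (r + 3 - 1)) ^ 2 := by
            rw [show r + 3 - 1 = r + 2 by omega]; ring
        _ ≤ _ := Nat.mul_le_mul_right _ (by split_ifs <;> omega)
  | coprime a b ha hb hab iha ihb =>
    rw [Nat.totient_mul hab]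
    refine (Nat.mul_le_mul iha ihb).trans ?_
    rw [mul_pow, mul_mul_mul_comm]
    refine Nat.mul_le_mul_right _ ?_
    have hodd : ¬ (a % 2 = 0 ∧ b % 2 = 0) := fun h =>
      Nat.not_coprime_of_dvd_of_dvd one_lt_two (Nat.dvd_of_mod_eq_zero h.1)
        (Nat.dvd_of_mod_eq_zero h.2) hab
    have hmul : a * b % 4 = (a % 4) * (b % 4) % 4 := Nat.mul_mod _ _ _
    have ha4 : a % 4 < 4 := Nat.mod_lt _ (by norm_num)
    have hb4 : b % 4 < 4 := Nat.mod_lt _ (by norm_num)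
    have ha2 : a % 2 = a % 4 % 2 := by omega
    have hb2 : b % 2 = b % 4 % 2 := by omega
    rw [hmul]
    rw [ha2, hb2] at hodd
    generalize a % 4 = u at *
    generalize b % 4 = v at *
    interval_cases u <;> interval_cases v <;> simp_all

universe u

section FieldStructure

variable {H : Type*} {V : Type u} [Group H] [AddCommGroup V] [DistribMulAction H V]

theorem exists_field_of_transitive_action [Finite V] [Nontrivial V]
    (htr : ∀ v w : V, v ≠ 0 → w ≠ 0 → ∃ h : H, h • v = w ∨ h • v = -w)
    (A : Subgroup H) (hA : A.Normal) (hcomm : ∀ x ∈ A, ∀ y ∈ A, x * y = y * x) :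
    ∃ (K : Type u) (_ : Field K) (_ : Finite K) (_ : Module K V) (ι : A →* K),
      (∀ (a : A) (v : V), ι a • v = (a : H) • v) ∧
      ∀ y ∈ Subgroup.centralizer (A : Set H), ∀ (c : K) (v : V), y • c • v = c • y • v := by
  let φ : H →* AddMonoid.End V := DistribMulAction.toAddMonoidEnd H V
  have hφ : ∀ (h : H) (v : V), φ h v = h • v := fun _ _ => rfl
  have : Finite (AddMonoid.End V) := DFunLike.finite (AddMonoid.End V)
  have hmul : ∀ (r t : AddMonoid.End V) v, (r * t) v = r (t v) := fun _ _ _ => rfl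
  have hneg : ∀ (r : AddMonoid.End V) v, (-r) v = -r v := fun _ _ => rfl
  have hone : ∀ v, (1 : AddMonoid.End V) v = v := fun _ => rfl
  let s : Set (AddMonoid.End V) := φ '' A
  have hs : ∀ x ∈ s, ∀ y ∈ s, x * y = y * x := by
    rintro _ ⟨x, hx, rfl⟩ _ ⟨y, hy, rfl⟩
    rw [← map_mul, ← map_mul, hcomm x hx y hy]
  let R := Subring.closure s
  let _ : CommRing R :=
    { (inferInstance : Ring R) with
      mul_comm := (Subring.isMulCommutative_closure hs).is_comm.comm }
  have hRcomm : ∀ r ∈ R, ∀ t ∈ R, r * t = t * r := fun r hr t ht =>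
    congrArg Subtype.val (mul_comm (⟨r, hr⟩ : R) ⟨t, ht⟩)
  have hconj : ∀ (h : H), ∀ r ∈ R, φ h * r * φ h⁻¹ ∈ R := by
    intro h r hr
    have hinv : φ h⁻¹ * φ h = 1 := by rw [← map_mul, inv_mul_cancel, map_one]
    have hinv' : φ h * φ h⁻¹ = 1 := by rw [← map_mul, mul_inv_cancel, map_one]
    induction hr using Subring.closure_induction with
    | mem x hx =>
      obtain ⟨a, ha, rfl⟩ := hx
      rw [← map_mul, ← map_mul]
      exact Subring.subset_closure ⟨_, hA.conj_mem a ha h, rfl⟩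
    | zero => simp [R.zero_mem]
    | one => simp [hinv', R.one_mem]
    | add x y _ _ hx hy => rw [mul_add, add_mul]; exact R.add_mem hx hy
    | neg x _ hx => rw [mul_neg, neg_mul]; exact R.neg_mem hx
    | mul x y _ _ hx hy =>
      have : φ h * (x * y) * φ h⁻¹ = (φ h * x * φ h⁻¹) * (φ h * y * φ h⁻¹) := by
        calc φ h * (x * y) * φ h⁻¹ = φ h * x * 1 * y * φ h⁻¹ := by simp only [mul_assoc, one_mul]
          _ = _ := by rw [← hinv]; simp only [mul_assoc]
      rw [this]; exact R.mul_mem hx hy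
  -- annihilators in `R` of nonzero vectors all have the same size, hence coincide
  let ann : V → Set (AddMonoid.End V) := fun v => {r | r ∈ R ∧ r v = 0}
  have hann_neg : ∀ v, ann (-v) = ann v := by
    intro v; ext r; simp [ann]
  have hann_smul : ∀ (h : H) v, (ann v).ncard ≤ (ann (h • v)).ncard := by
    intro h v
    refine Set.ncard_le_ncard_of_injOn (fun r => φ h * r * φ h⁻¹) ?_ ?_ (Set.toFinite _)
    · rintro r ⟨hr, hrv⟩
      refine ⟨hconj h r hr, ?_⟩
      simp [hmul, hφ, hrv]
    · intro r _ t _ hrt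
      ext v
      have := DFunLike.congr_fun hrt (h • v)
      simpa [hmul, hφ] using this
  have hann_card : ∀ v w, v ≠ 0 → w ≠ 0 → (ann v).ncard ≤ (ann w).ncard := by
    intro v w hv hw
    obtain ⟨h, rfl | h'⟩ := htr v w hv hw
    · exact hann_smul h v
    · rw [← hann_neg w, ← h']; exact hann_smul h v
  have hann_sub : ∀ v w, v ≠ 0 → w ≠ 0 → ann v ⊆ ann w → ann v = ann w := fun v w hv hw h =>
    Set.eq_of_subset_of_ncard_le h (hann_card w v hw hv) (Set.toFinite _)
  have hann_mul : ∀ r ∈ R, ∀ v, ann v ⊆ ann (r v) := by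
    rintro r hr v t ⟨ht, htv⟩
    refine ⟨ht, ?_⟩
    rw [← hmul, hRcomm t ht r hr, hmul, htv, map_zero]
  have hann_eq : ∀ v w, v ≠ 0 → w ≠ 0 → ann v = ann w := by
    intro v w hv hw
    by_cases hex : ∃ r ∈ R, ∃ t ∈ R, r v = t w ∧ r v ≠ 0
    · obtain ⟨r, hr, t, ht, hrt, hne⟩ := hex
      rw [hann_sub v (r v) hv hne (hann_mul r hr v), hrt]
      exact (hann_sub w (t w) hw (hrt ▸ hne) (hann_mul t ht w)).symm
    · push Not at hex
      have hvw : v + w ≠ 0 := fun h => hv (hex 1 R.one_mem (-1) (R.neg_mem R.one_mem)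
        (by rw [hneg, hone, hone]; exact eq_neg_of_add_eq_zero_left h))
      have key : ∀ r ∈ ann (v + w), r v = 0 := by
        rintro r ⟨hr, hrv⟩
        rw [map_add] at hrv
        exact hex r hr (-r) (R.neg_mem hr) (by rw [hneg]; exact eq_neg_of_add_eq_zero_left hrv)
      rw [← hann_sub (v + w) v hvw hv fun r hr => ⟨hr.1, key r hr⟩]
      refine hann_sub (v + w) w hvw hw fun r hr => ⟨hr.1, ?_⟩
      have := hr.2
      rwa [map_add, key r hr, zero_add] at this
  have hinj : ∀ r ∈ R, ∀ v, v ≠ 0 → r v = 0 → r = 0 := by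
    intro r hr v hv hrv
    ext w
    by_cases hw : w = 0
    · simp [hw]
    · have : r ∈ ann w := hann_eq v w hv hw ▸ ⟨hr, hrv⟩
      exact this.2
  obtain ⟨v0, hv0⟩ := exists_ne (0 : V)
  have hnt : Nontrivial R := ⟨⟨0, 1, fun h => hv0 (by
    have := DFunLike.congr_fun (congrArg Subtype.val h) v0
    simpa using this.symm)⟩⟩
  have hnzd : NoZeroDivisors R := ⟨by
    intro a b hab
    by_contra! hne
    obtain ⟨v, hv⟩ : ∃ v, (b : AddMonoid.End V) v ≠ 0 := by
      by_contra! hb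
      exact hne.2 (Subtype.ext (by ext v; simpa using hb v))
    refine hne.1 (Subtype.ext (hinj a a.2 _ hv ?_))
    have := DFunLike.congr_fun (congrArg Subtype.val hab) v
    simpa using this⟩
  have hdom : IsDomain R := NoZeroDivisors.to_isDomain R
  refine ⟨R, (Finite.isField_of_domain R).toField, inferInstance,
    (inferInstance : Module R V), ?_, ?_, ?_⟩
  · exact
      { toFun := fun a => ⟨φ a, Subring.subset_closure ⟨a, a.2, rfl⟩⟩
        map_one' := Subtype.ext (by simp)
        map_mul' := fun a b => Subtype.ext (by simp) }
  · intro a v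
    rfl
  · intro y hy c v
    have hle : R ≤ Subring.centralizer {φ y} := by
      refine Subring.closure_le.2 ?_
      rintro _ ⟨a, ha, rfl⟩
      rw [SetLike.mem_coe, Subring.mem_centralizer_iff]
      rintro _ rfl
      rw [← map_mul, ← map_mul, Subgroup.mem_centralizer_iff.1 hy a ha]
    exact DFunLike.congr_fun (Subring.mem_centralizer_iff.1 (hle c.2) _ rfl) v

variable {K : Type*} [Field K] [Module K V] {A : Subgroup H} {ι : A →* K}

theorem injective_of_smul_eq [Nontrivial V]
    (hfpf : ∀ (h : H) (v : V), v ≠ 0 → h • v = v → h = 1)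
    (hι : ∀ (a : A) (v : V), ι a • v = (a : H) • v) : Function.Injective ι := by
  rw [injective_iff_map_eq_one']
  intro a
  refine ⟨fun h => ?_, fun h => by rw [h, map_one]⟩
  obtain ⟨v, hv⟩ := exists_ne (0 : V)
  exact Subtype.ext (hfpf a v hv (by rw [← hι, h, one_smul]))

open Polynomial in
theorem aeval_conj_smul {p : ℕ} [Algebra (ZMod p) K] [hA : A.Normal]
    (hι : ∀ (a : A) (v : V), ι a • v = (a : H) • v) (a : A) (h : H) (f : (ZMod p)[X]) (v : V) :
    aeval (ι ⟨h * a * h⁻¹, hA.conj_mem a a.2 h⟩) f • v = h • aeval (ι a) f • h⁻¹ • v := by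
  induction f using Polynomial.induction_on' with
  | add f g hf hg => simp only [map_add, add_smul, hf, hg, smul_add]
  | monomial n c =>
    obtain ⟨c, rfl⟩ := ZMod.intCast_surjective c
    simp only [aeval_monomial, map_intCast, mul_smul, ← map_pow, hι, Int.cast_smul_eq_zsmul]
    rw [smul_comm h c]
    congr 1
    simp only [SubmonoidClass.mk_pow, conj_pow, mul_smul, SubmonoidClass.coe_pow]

open Polynomial in
theorem ncard_conjugatesOf_le [Finite K] [Nontrivial V] {p d : ℕ} (hp : p.Prime)
    (hpV : ∀ v : V, p • v = 0) (hfpf : ∀ (h : H) (v : V), v ≠ 0 → h • v = v → h = 1)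
    (hA : A.Normal) (hι : ∀ (a : A) (v : V), ι a • v = (a : H) • v)
    (hd : Nat.card K = p ^ d) (a : A) : (conjugatesOf (a : H)).ncard ≤ d := by
  have := Fact.mk hp
  obtain ⟨v, hv⟩ := exists_ne (0 : V)
  have hpK : (p : K) = 0 := by
    have h : (p : K) • v = 0 := by rw [Nat.cast_smul_eq_nsmul, hpV]
    exact (smul_eq_zero.1 h).resolve_right hv
  have hchar : CharP K p := (CharP.charP_iff_prime_eq_zero hp).2 hpK
  let _ : Algebra (ZMod p) K := ZMod.algebra K p
  let _ := Fintype.ofFinite K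
  have hfin : Module.finrank (ZMod p) K = d := by
    have h := Module.card_eq_pow_finrank (K := ZMod p) (V := K)
    rw [ZMod.card, ← Nat.card_eq_fintype_card, hd] at h
    exact (Nat.pow_right_injective hp.two_le h).symm
  set f := minpoly (ZMod p) (ι a) with hf
  have hintegral : IsIntegral (ZMod p) (ι a) := Algebra.IsIntegral.isIntegral _
  have hf0 : f.map (algebraMap (ZMod p) K) ≠ 0 :=
    Polynomial.map_ne_zero (minpoly.ne_zero hintegral)
  have hmem : ∀ x ∈ conjugatesOf (a : H), x ∈ A := by
    intro x hx
    obtain ⟨h, rfl⟩ := isConj_iff.1 (show IsConj (a : H) x from hx)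
    exact hA.conj_mem a a.2 h
  classical
  calc (conjugatesOf (a : H)).ncard
      ≤ ((f.map (algebraMap (ZMod p) K)).roots.toFinset : Set K).ncard := by
        refine Set.ncard_le_ncard_of_injOn
          (fun x => if hx : x ∈ A then ι ⟨x, hx⟩ else 0) ?_ ?_ (Set.toFinite _)
        · intro x hx
          simp only [dif_pos (hmem x hx)]
          obtain ⟨h, rfl⟩ := isConj_iff.1 (show IsConj (a : H) x from hx)
          rw [Finset.mem_coe, Multiset.mem_toFinset, mem_roots hf0, IsRoot, eval_map_algebraMap]
          have h1 := aeval_conj_smul hι a h f v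
          rw [hf, minpoly.aeval, zero_smul, smul_zero] at h1
          exact (smul_eq_zero.1 h1).resolve_right hv
        · intro x hx y hy hxy
          simp only [dif_pos (hmem x hx), dif_pos (hmem y hy)] at hxy
          exact congrArg Subtype.val (injective_of_smul_eq hfpf hι hxy)
    _ ≤ d := by
        rw [Set.ncard_coe_finset, ← hfin]
        refine (Multiset.toFinset_card_le _).trans ((card_roots' _).trans ?_)
        rw [natDegree_map]
        exact minpoly.natDegree_le _

open Polynomial in
theorem mem_of_mem_centralizer_of_pow_eq_one [Finite A] [Finite V] [Nontrivial V]
    (hfpf : ∀ (h : H) (v : V), v ≠ 0 → h • v = v → h = 1)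
    (hι : ∀ (a : A) (v : V), ι a • v = (a : H) • v)
    (hcl : ∀ y ∈ Subgroup.centralizer (A : Set H), ∀ (c : K) (v : V), y • c • v = c • y • v)
    {q : ℕ} (hq : q.Prime) (hdvd : q ∣ Nat.card A) {y : H}
    (hy : y ∈ Subgroup.centralizer (A : Set H)) (hyq : y ^ q = 1) : y ∈ A := by
  have := Fact.mk hq
  obtain ⟨z, hz⟩ := exists_prime_orderOf_dvd_card' q hdvd
  have hprim : IsPrimitiveRoot (ι z) q := by
    rw [IsPrimitiveRoot.iff_orderOf, orderOf_injective ι (injective_of_smul_eq hfpf hι), hz]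
  let T : Module.End K V :=
    { toFun := fun v => y • v
      map_add' := smul_add y
      map_smul' := fun c v => hcl y hy c v }
  have hT : ∀ (n : ℕ) v, (T ^ n) v = y ^ n • v := by
    intro n
    induction n with
    | zero => simp
    | succ n ih =>
      intro v
      rw [pow_succ, Module.End.mul_apply, ih, pow_succ, mul_smul]
      rfl
  have hTq : aeval T (X ^ q - 1 : K[X]) = 0 := by
    ext v
    simp [hT, hyq]
  have hintegral : IsIntegral K T := Algebra.IsIntegral.isIntegral _
  have hsplit : (minpoly K T).Splits :=
    (X_pow_sub_one_splits hprim).of_dvd (X_pow_sub_C_ne_zero hq.pos 1) (by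
      simpa using minpoly.dvd K T hTq)
  obtain ⟨μ, hμ⟩ := hsplit.exists_eval_eq_zero (minpoly.degree_pos hintegral).ne'
  obtain ⟨v, hv⟩ := (Module.End.hasEigenvalue_of_isRoot hμ).exists_hasEigenvector
  have hv0 : v ≠ 0 := hv.2
  have hyv : y • v = μ • v := hv.apply_eq_smul
  have hpow : ∀ n : ℕ, y ^ n • v = μ ^ n • v := by
    intro n
    induction n with
    | zero => simp
    | succ n ih => rw [pow_succ, mul_smul, hyv, hcl _ (pow_mem hy n), ih, ← mul_smul, pow_succ']
  have hμq : μ ^ q = 1 := by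
    have h := hpow q
    rw [hyq, one_smul] at h
    have h2 : (μ ^ q - 1) • v = 0 := by rw [sub_smul, one_smul, ← h, sub_self]
    exact sub_eq_zero.1 ((smul_eq_zero.1 h2).resolve_right hv0)
  obtain ⟨i, -, hi⟩ := hprim.eq_pow_of_pow_eq_one hμq
  have hzy : ((z ^ i : A) : H)⁻¹ * y = 1 := by
    refine hfpf _ v hv0 ?_
    rw [mul_smul, hyv, ← hi, ← map_pow, hι, ← mul_smul, inv_mul_cancel, one_smul]
  rw [← inv_mul_eq_one.1 hzy]
  exact (z ^ i).2

end FieldStructure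

section MaximalAbelianNormal

variable {H : Type*} [Group H]

theorem mul_pow_eq_of_mul_eq {x y z : H} (hy : Commute z y) (hxy : x * y = z * (y * x)) (n : ℕ) :
    x * y ^ n = z ^ n * (y ^ n * x) := by
  induction n with
  | zero => simp
  | succ n ih =>
    calc x * y ^ (n + 1) = x * y ^ n * y := by rw [pow_succ, mul_assoc]
      _ = z ^ n * (y ^ n * (x * y)) := by rw [ih]; simp only [mul_assoc]
      _ = z ^ n * (y ^ n * z) * (y * x) := by rw [hxy]; simp only [mul_assoc]
      _ = z ^ (n + 1) * (y ^ (n + 1) * x) := by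
        rw [← (hy.pow_right n).eq, pow_succ, pow_succ]; simp only [mul_assoc]

theorem mul_pow_of_mul_eq {x y z : H} (hx : Commute z x) (hy : Commute z y)
    (hxy : x * y = z * (y * x)) (n : ℕ) : (y * x) ^ n = z ^ n.choose 2 * (y ^ n * x ^ n) := by
  induction n with
  | zero => simp
  | succ n ih =>
    calc (y * x) ^ (n + 1) = y * x * (z ^ n.choose 2 * (y ^ n * x ^ n)) := by rw [pow_succ', ih]
      _ = (y * x) * z ^ n.choose 2 * (y ^ n * x ^ n) := by rw [mul_assoc, mul_assoc, mul_assoc]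
      _ = z ^ n.choose 2 * y * (x * y ^ n) * x ^ n := by
        rw [← ((hy.mul_right hx).pow_left (n.choose 2)).eq]; simp only [mul_assoc]
      _ = z ^ n.choose 2 * (y * z ^ n) * (y ^ n * x * x ^ n) := by
        rw [mul_pow_eq_of_mul_eq hy hxy]; simp only [mul_assoc]
      _ = z ^ (n + 1).choose 2 * (y ^ (n + 1) * x ^ (n + 1)) := by
        rw [← (hy.pow_left n).eq, Nat.choose_succ_succ' n 1, Nat.choose_one_right, add_comm n,
          pow_add, pow_succ' y, pow_succ' x]
        simp only [mul_assoc]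

theorem IsCyclic.exists_zpow_mul_pow {A : Type*} [Group A] [IsCyclic A] {q : ℕ} (hq : q.Prime)
    {u : A} (hu : ∀ a : A, a ^ q ≠ u) (w : A) : ∃ (i : ℤ) (a : A), w = u ^ i * a ^ q := by
  obtain ⟨g, hg⟩ := IsCyclic.exists_generator (α := A)
  obtain ⟨s, rfl⟩ := hg u
  obtain ⟨t, rfl⟩ := hg w
  have hs : ¬ (q : ℤ) ∣ s := by
    rintro ⟨k, rfl⟩
    refine hu (g ^ k) ?_
    simp only [← zpow_natCast, ← zpow_mul, mul_comm]
  have hcop : IsCoprime (q : ℤ) s :=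
    (Prime.coprime_iff_not_dvd (Nat.prime_iff_prime_int.1 hq)).2 hs
  obtain ⟨α, β, hαβ⟩ := hcop
  refine ⟨t * β, g ^ (t * α), ?_⟩
  simp only [← zpow_natCast, ← zpow_mul, ← zpow_add]
  congr 1
  linear_combination (-t) * hαβ

/-- A maximal abelian normal subgroup `A`, assumed cyclic and such that its centralizer has no
elements of prime order dividing `|A|` outside of `A`. -/
structure Subgroup.IsMaxCyclicNormal (A : Subgroup H) : Prop where
  normal : A.Normal
  cyclic : IsCyclic A
  le_of_comm : ∀ B : Subgroup H, B.Normal → A ≤ B → (∀ x ∈ B, ∀ y ∈ B, x * y = y * x) → B ≤ A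
  mem_of_pow : ∀ q : ℕ, q.Prime → q ∣ Nat.card A →
    ∀ y ∈ Subgroup.centralizer (A : Set H), y ^ q = 1 → y ∈ A

namespace Subgroup.IsMaxCyclicNormal

variable {A : Subgroup H}

theorem commute (_ : A.IsMaxCyclicNormal) {a x : H} (ha : a ∈ A)
    (hx : x ∈ Subgroup.centralizer (A : Set H)) : Commute a x :=
  Subgroup.mem_centralizer_iff.1 hx a ha

theorem le_centralizer (hA : A.IsMaxCyclicNormal) : A ≤ Subgroup.centralizer (A : Set H) := by
  intro x hx
  rw [Subgroup.mem_centralizer_iff]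
  intro y hy
  have := hA.cyclic
  let _ : CommGroup A := IsCyclic.commGroup
  exact congrArg Subtype.val (mul_comm (⟨y, hy⟩ : A) ⟨x, hx⟩)

theorem mem_of_pow_eq_pow (hA : A.IsMaxCyclicNormal) {q : ℕ} (hq : q.Prime)
    (hqA : q ∣ Nat.card A) {x a : H} (hx : x ∈ Subgroup.centralizer (A : Set H)) (ha : a ∈ A)
    (h : x ^ q = a ^ q) : x ∈ A := by
  have hc : Commute x a⁻¹ := (hA.commute ha hx).symm.inv_right
  have h1 : x * a⁻¹ ∈ A := by
    refine hA.mem_of_pow q hq hqA _ (mul_mem hx (inv_mem (hA.le_centralizer ha))) ?_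
    rw [hc.mul_pow, h, inv_pow, mul_inv_cancel]
  simpa using mul_mem h1 ha

theorem exists_eq_zpow_mul_pow (hA : A.IsMaxCyclicNormal) {q : ℕ} (hq : q.Prime)
    (hqA : q ∣ Nat.card A) {x w : H} (hx : x ∈ Subgroup.centralizer (A : Set H)) (hxA : x ∉ A)
    (hxq : x ^ q ∈ A) (hw : w ∈ A) : ∃ (i : ℤ), ∃ a ∈ A, w = (x ^ q) ^ i * a ^ q := by
  have := hA.cyclic
  obtain ⟨i, a, h⟩ := IsCyclic.exists_zpow_mul_pow hq (u := (⟨x ^ q, hxq⟩ : A)) (fun a h =>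
    hxA (hA.mem_of_pow_eq_pow hq hqA hx a.2 (congrArg Subtype.val h).symm)) ⟨w, hw⟩
  exact ⟨i, a, a.2, congrArg Subtype.val h⟩

theorem mul_mem_of_commute (hA : A.IsMaxCyclicNormal) (h2 : 2 ∣ Nat.card A) {x y : H}
    (hx : x ∈ Subgroup.centralizer (A : Set H)) (hy : y ∈ Subgroup.centralizer (A : Set H))
    (hxA : x ∉ A) (hyA : y ∉ A) (hx2 : x ^ 2 ∈ A) (hy2 : y ^ 2 ∈ A) (hxy : Commute x y) :
    x * y ∈ A := by
  obtain ⟨i, a, ha, h⟩ := hA.exists_eq_zpow_mul_pow Nat.prime_two h2 hx hxA hx2 hy2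
  have hxa : Commute (x ^ 2) a := (hA.commute ha (pow_mem hx 2)).symm
  rcases Int.even_or_odd' i with ⟨k, rfl | rfl⟩
  · refine absurd (hA.mem_of_pow_eq_pow Nat.prime_two h2 hy (a := (x ^ 2) ^ k * a)
      (mul_mem (zpow_mem hx2 k) ha) ?_) hyA
    rw [h, (hxa.zpow_left k).mul_pow, mul_comm 2 k, zpow_mul, zpow_ofNat]
  · refine hA.mem_of_pow_eq_pow Nat.prime_two h2 (mul_mem hx hy) (a := (x ^ 2) ^ (k + 1) * a)
      (mul_mem (zpow_mem hx2 _) ha) ?_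
    rw [hxy.mul_pow, h, (hxa.zpow_left (k + 1)).mul_pow, ← mul_assoc, ← zpow_one_add]
    congr 1
    rw [← zpow_ofNat ((x ^ 2) ^ (k + 1)) 2, ← zpow_mul]
    congr 1
    ring

theorem pow_eq_one_of_mul_eq {q : ℕ} (hA : A.IsMaxCyclicNormal) {x y z : H}
    (hx : x ∈ Subgroup.centralizer (A : Set H)) (hy : y ∈ Subgroup.centralizer (A : Set H))
    (hz : z ∈ A) (hyq : y ^ q ∈ A) (hxy : x * y = z * (y * x)) : z ^ q = 1 := by
  have h := mul_pow_eq_of_mul_eq (hA.commute hz hy) hxy q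
  rw [(hA.commute hyq hx).eq] at h
  exact mul_eq_right.1 h.symm

theorem eq_two_of_not_commute (hA : A.IsMaxCyclicNormal) {q : ℕ} (hq : q.Prime)
    (hqA : q ∣ Nat.card A) {B : Subgroup H} (hBC : B ≤ Subgroup.centralizer (A : Set H))
    (hpow : ∀ x ∈ B, x ^ q ∈ A)
    (hcomm : ∀ x ∈ B, ∀ y ∈ B, x * y * x⁻¹ * y⁻¹ ∈ A) {x y : H} (hx : x ∈ B) (hy : y ∈ B)
    (hxy : ¬ Commute x y) : q = 2 := by
  by_contra hq2
  have hxA : x ∉ A := fun h => hxy (hA.commute h (hBC hy))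
  obtain ⟨i, a, ha, h⟩ := hA.exists_eq_zpow_mul_pow hq hqA (hBC hx) hxA (hpow x hx) (hpow y hy)
  set t := x ^ (-i) with ht
  have htB : t ∈ B := zpow_mem hx _
  set z := t * y * t⁻¹ * y⁻¹ with hz
  have hzA : z ∈ A := hcomm t htB y hy
  have hty : t * y = z * (y * t) := by rw [hz]; group
  have hdvd : q ∣ q.choose 2 :=
    hq.dvd_choose_self two_ne_zero (lt_of_le_of_ne hq.two_le (Ne.symm hq2))
  obtain ⟨k, hk⟩ := hdvd
  have hpw := mul_pow_of_mul_eq (hA.commute hzA (hBC htB)) (hA.commute hzA (hBC hy)) hty q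
  have hyt : y ^ q * t ^ q = a ^ q := by
    have h1 : t ^ q = ((x ^ q) ^ i)⁻¹ := by
      rw [ht, ← zpow_natCast, ← zpow_mul, ← zpow_natCast, ← zpow_mul, ← zpow_neg]
      congr 1; ring
    rw [h, h1, ((hA.commute (pow_mem ha q) (pow_mem (hBC hx) q)).symm.zpow_left i).eq,
      mul_inv_cancel_right]
  have hza : Commute z a := hA.commute hzA (hA.le_centralizer ha)
  have hmem : y * t ∈ A := by
    refine hA.mem_of_pow_eq_pow hq hqA (hBC (mul_mem hy htB)) (a := z ^ k * a)
      (mul_mem (pow_mem hzA k) ha) ?_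
    rw [hpw, hyt, hk, (hza.pow_left k).mul_pow, ← pow_mul, mul_comm k]
  refine hxy ?_
  have h1 : Commute (y * t) x := hA.commute hmem (hBC hx)
  have h2 : Commute (y * t * t⁻¹) x :=
    h1.mul_left ((Commute.refl x).zpow_left (-i)).inv_left
  rw [mul_inv_cancel_right] at h2
  exact h2.symm

theorem exists_noncommutative_section [Finite H] (hA : A.IsMaxCyclicNormal)
    (hMP : MagnusProperty H) {D : Subgroup H} (hD : D.Normal) (hAD : A ≤ D)
    (hDC : D ≤ Subgroup.centralizer (A : Set H)) (hne : ¬ D ≤ A) :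
    2 ∣ Nat.card A ∧ ∃ B : Subgroup H, B.Normal ∧ A ≤ B ∧ B ≤ D ∧ (∀ x ∈ B, x ^ 2 ∈ A) ∧
      (∀ x ∈ B, ∀ y ∈ B, x * y * x⁻¹ * y⁻¹ ∈ A) ∧ ∃ x ∈ B, ∃ y ∈ B, ¬ Commute x y := by
  have hAn := hA.normal
  let π := QuotientGroup.mk' A
  have hπ : Function.Surjective π := QuotientGroup.mk'_surjective A
  have hbot : D.map π ≠ ⊥ := by
    rw [Ne, Subgroup.map_eq_bot_iff, QuotientGroup.ker_mk']
    exact hne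
  obtain ⟨N, hN, hND⟩ :=
    Subgroup.exists_isMinimalNormal_le (D.map π) (hD.map π hπ) hbot
  have hMPq := hMP.quotient_s5 A
  obtain ⟨q, hq, hqN⟩ := hN.exists_prime
  set B := N.comap π with hB
  have hBn : B.Normal := hN.normal.comap π
  have hAB : A ≤ B := by
    intro a ha
    rw [hB, Subgroup.mem_comap, show π a = 1 from (QuotientGroup.eq_one_iff a).2 ha]
    exact N.one_mem
  have hBD : B ≤ D := by
    intro b hb
    obtain ⟨d, hd, hdb⟩ := hND (Subgroup.mem_comap.1 hb)
    have : d⁻¹ * b ∈ A := QuotientGroup.eq.1 hdb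
    simpa using mul_mem hd (hAD this)
  have hBC := hBD.trans hDC
  have hpow : ∀ x ∈ B, x ^ q ∈ A := by
    intro x hx
    rw [← QuotientGroup.eq_one_iff, QuotientGroup.mk_pow]
    exact hN.pow_eq_one hMPq hq hqN hx
  have hcomm : ∀ x ∈ B, ∀ y ∈ B, x * y * x⁻¹ * y⁻¹ ∈ A := by
    intro x hx y hy
    rw [← QuotientGroup.eq_one_iff]
    have h : (x : H ⧸ A) * y = y * x := hN.mul_comm hMPq hx hy
    simp only [QuotientGroup.mk_mul, QuotientGroup.mk_inv]
    rw [h]; simp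
  have hnc : ∃ x ∈ B, ∃ y ∈ B, ¬ Commute x y := by
    by_contra! hcon
    have hle := hA.le_of_comm B hBn hAB fun x hx y hy => hcon x hx y hy
    refine hN.ne_bot ?_
    rw [← Subgroup.map_comap_eq_self_of_surjective hπ N, Subgroup.map_eq_bot_iff,
      QuotientGroup.ker_mk']
    exact hle
  obtain ⟨x, hx, y, hy, hxy⟩ := hnc
  have hz := hcomm x hx y hy
  have hqA : q ∣ Nat.card A := by
    set z := x * y * x⁻¹ * y⁻¹ with hzdef
    have hz1 : z ≠ 1 := by
      intro h
      refine hxy ?_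
      rw [hzdef, mul_inv_eq_one, mul_inv_eq_iff_eq_mul] at h
      exact h
    have hzq : z ^ q = 1 := hA.pow_eq_one_of_mul_eq (hBC hx) (hBC hy) hz (hpow y hy)
      (by rw [hzdef]; group)
    have hfq := Fact.mk hq
    have ho : orderOf (⟨z, hz⟩ : A) = q :=
      orderOf_eq_prime (Subtype.ext hzq) (fun h => hz1 (congrArg Subtype.val h))
    rw [← ho]
    exact _root_.orderOf_dvd_natCard _
  obtain rfl := hA.eq_two_of_not_commute hq hqA hBC hpow hcomm hx hy hxy
  exact ⟨hqA, B, hBn, hAB, hBD, hpow, hcomm, x, hx, y, hy, hxy⟩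

theorem exists_mul_commute (hA : A.IsMaxCyclicNormal) {x y z w : H}
    (hx : x ∈ Subgroup.centralizer (A : Set H)) (hy : y ∈ Subgroup.centralizer (A : Set H))
    (hw : w ∈ Subgroup.centralizer (A : Set H)) (hz : z ∈ A) (hz2 : z * z = 1)
    (hxy : x * y = z * (y * x)) (hwx : w * x = x * w ∨ w * x = z * (x * w))
    (hwy : w * y = y * w ∨ w * y = z * (y * w)) :
    ∃ s : H, (s = 1 ∨ s = x ∨ s = y ∨ s = x * y) ∧ Commute (w * s) x ∧ Commute (w * s) y := by
  have hyx : y * x = z * (x * y) := by rw [hxy, ← mul_assoc, hz2, one_mul]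
  have flip : ∀ v s : H, w * v = z * (v * w) → s * v = z * (v * s) → Commute (w * s) v := by
    intro v s hwv hsv
    calc w * s * v = w * z * v * s := by rw [mul_assoc, hsv]; simp only [mul_assoc]
      _ = z * (w * v) * s := by rw [← (hA.commute hz hw).eq]; simp only [mul_assoc]
      _ = (z * z) * (v * (w * s)) := by rw [hwv]; simp only [mul_assoc]
      _ = v * (w * s) := by rw [hz2, one_mul]
  have hxyx : x * y * x = z * (x * (x * y)) := by
    rw [mul_assoc, hyx, ← mul_assoc x z, ← (hA.commute hz hx).eq, mul_assoc]
  have hxyy : x * y * y = z * (y * (x * y)) := by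
    rw [hxy, mul_assoc, mul_assoc, hxy, ← mul_assoc y z, ← (hA.commute hz hy).eq, mul_assoc]
  rcases hwx with hwx | hwx <;> rcases hwy with hwy | hwy
  · exact ⟨1, by simp, by rw [mul_one]; exact hwx, by rw [mul_one]; exact hwy⟩
  · exact ⟨x, by simp, Commute.mul_left hwx (Commute.refl x), flip y x hwy hxy⟩
  · exact ⟨y, by simp, flip x y hwx hyx, Commute.mul_left hwy (Commute.refl y)⟩
  · exact ⟨x * y, by simp, flip x _ hwx hxyx, flip y _ hwy hxyy⟩

theorem eq_one_or_eq_of_mul_self (hA : A.IsMaxCyclicNormal) [Finite H] {z u : H} (hz : z ∈ A)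
    (hz1 : z ≠ 1) (hz2 : z * z = 1) (hu : u ∈ A) (hu2 : u * u = 1) : u = 1 ∨ u = z := by
  have := hA.cyclic
  by_contra! hne
  classical
  let _ := Fintype.ofFinite A
  have hle := IsCyclic.card_pow_eq_one_le (α := A) (n := 2) two_pos
  have hsub : ({1, ⟨z, hz⟩, ⟨u, hu⟩} : Finset A) ⊆ Finset.univ.filter (fun a : A => a ^ 2 = 1) := by
    intro a ha
    simp only [Finset.mem_insert, Finset.mem_singleton] at ha
    simp only [Finset.mem_filter, Finset.mem_univ, true_and]
    rcases ha with rfl | rfl | rfl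
    · simp
    · exact Subtype.ext (by simpa [pow_two] using hz2)
    · exact Subtype.ext (by simpa [pow_two] using hu2)
  have h3 : ({1, ⟨z, hz⟩, ⟨u, hu⟩} : Finset A).card = 3 := by
    rw [Finset.card_eq_three]
    refine ⟨_, _, _, ?_, ?_, ?_, rfl⟩
    · exact fun h => hz1 (congrArg Subtype.val h).symm
    · exact fun h => hne.1 (congrArg Subtype.val h).symm
    · exact fun h => hne.2 (congrArg Subtype.val h).symm
  have := (Finset.card_le_card hsub).trans hle
  omega

theorem card_centralizer_le [Finite H] (hA : A.IsMaxCyclicNormal) (hMP : MagnusProperty H)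
    (hne : ¬ Subgroup.centralizer (A : Set H) ≤ A) :
    2 ∣ Nat.card A ∧ Nat.card (Subgroup.centralizer (A : Set H)) ≤ 24 * Nat.card A := by
  have hAn := hA.normal
  set C := Subgroup.centralizer (A : Set H) with hC
  obtain ⟨h2, B, hBn, hAB, hBC, hpow, hcomm, x, hx, y, hy, hxy⟩ :=
    hA.exists_noncommutative_section hMP (D := C) inferInstance hA.le_centralizer le_rfl hne
  refine ⟨h2, ?_⟩
  set z := x * y * x⁻¹ * y⁻¹ with hzdef
  have hxyz : x * y = z * (y * x) := by rw [hzdef]; group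
  have hz : z ∈ A := hcomm x hx y hy
  have hz1 : z ≠ 1 := by
    intro h
    rw [h, one_mul] at hxyz
    exact hxy hxyz
  have hz2 : z * z = 1 := by
    rw [← pow_two]; exact hA.pow_eq_one_of_mul_eq (hBC hx) (hBC hy) hz (hpow y hy) hxyz
  have hxA : x ∉ A := fun h => hxy (hA.commute h (hBC hy))
  have hyA : y ∉ A := fun h => hxy (hA.commute h (hBC hx)).symm
  have hS : ∀ s : H, (s = 1 ∨ s = x ∨ s = y ∨ s = x * y) → s ∈ B := by
    rintro s (rfl | rfl | rfl | rfl)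
    exacts [B.one_mem, hx, hy, mul_mem hx hy]
  have hBz : ∀ w ∈ B, ∀ t ∈ B, w * t = t * w ∨ w * t = z * (t * w) := by
    intro w hw t ht
    have hc := hcomm w hw t ht
    set u := w * t * w⁻¹ * t⁻¹ with hu
    have hwt : w * t = u * (t * w) := by rw [hu]; group
    have hu2 : u * u = 1 := by
      rw [← pow_two]; exact hA.pow_eq_one_of_mul_eq (hBC hw) (hBC ht) hc (hpow t ht) hwt
    rcases hA.eq_one_or_eq_of_mul_self hz hz1 hz2 hc hu2 with h | h
    · left; rwa [h, one_mul] at hwt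
    · right; rwa [h] at hwt
  -- `B` is generated by `A`, `x` and `y`
  have hBgen : ∀ w ∈ B, ∃ s, (s = 1 ∨ s = x ∨ s = y ∨ s = x * y) ∧ w * s ∈ A := by
    intro w hw
    obtain ⟨s, hs, hsx, hsy⟩ := hA.exists_mul_commute (hBC hx) (hBC hy) (hBC hw) hz hz2 hxyz
      (hBz w hw x hx) (hBz w hw y hy)
    refine ⟨s, hs, ?_⟩
    by_contra hsA
    have hwsB : w * s ∈ B := mul_mem hw (hS s hs)
    have h1 := hA.mul_mem_of_commute h2 (hBC hwsB) (hBC hx) hsA hxA (hpow _ hwsB) (hpow x hx) hsx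
    have h3 : Commute x y := by
      have h4 := (hA.commute h1 (hBC hy))
      have h5 := (hsy.inv_left).mul_left h4
      rwa [inv_mul_cancel_left] at h5
    exact hxy h3
  -- the centralizer of `B` is `A`
  have hAE : A ≤ Subgroup.centralizer (B : Set H) := by
    intro a ha
    rw [Subgroup.mem_centralizer_iff]
    intro b hb
    exact (hA.commute ha (hBC hb)).eq.symm
  have hEC : Subgroup.centralizer (B : Set H) ≤ C := Subgroup.centralizer_le hAB
  have hE : Subgroup.centralizer (B : Set H) ≤ A := by
    by_contra hne2
    obtain ⟨-, B', -, -, hB'E, hpow', -, x', hx', y', hy', hxy'⟩ :=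
      hA.exists_noncommutative_section hMP inferInstance hAE hEC hne2
    have hx'E := hB'E hx'
    have hx'A : x' ∉ A := fun h => hxy' (hA.commute h (hEC (hB'E hy')))
    have hcx := Subgroup.mem_centralizer_iff.1 hx'E x hx
    have hcy := Subgroup.mem_centralizer_iff.1 hx'E y hy
    have h1 := hA.mul_mem_of_commute h2 (hBC hx) (hEC hx'E) hxA hx'A (hpow x hx) (hpow' x' hx') hcx
    have h4 := hA.commute h1 (hBC hy)
    have h5 := h4.mul_left (Commute.inv_left (show Commute x' y from hcy.symm))
    rw [mul_inv_cancel_right] at h5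
    exact hxy h5
  have hcent : ∀ w ∈ C, Commute w x → Commute w y → w ∈ A := by
    intro w hw hwx hwy
    refine hE (Subgroup.mem_centralizer_iff.2 fun t ht => ?_)
    obtain ⟨s, hs, hts⟩ := hBgen t ht
    have hsw : Commute s w := by
      rcases hs with rfl | rfl | rfl | rfl
      exacts [Commute.one_left w, hwx.symm, hwy.symm, hwx.symm.mul_left hwy.symm]
    have h1 := (hA.commute hts hw).mul_left hsw.inv_left
    rw [mul_inv_cancel_right] at h1
    exact h1
  have hadj : ∀ w ∈ C, (w * x = x * w ∨ w * x = z * (x * w)) →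
      (w * y = y * w ∨ w * y = z * (y * w)) →
      ∃ s, (s = 1 ∨ s = x ∨ s = y ∨ s = x * y) ∧ w * s ∈ A := by
    intro w hw hwx hwy
    obtain ⟨s, hs, hsx, hsy⟩ := hA.exists_mul_commute (hBC hx) (hBC hy) hw hz hz2 hxyz hwx hwy
    exact ⟨s, hs, hcent _ (mul_mem hw (hBC (hS s hs))) hsx hsy⟩
  -- count `C` through its action on the cosets of `x` and `y`
  classical
  let _ := Fintype.ofFinite H
  let T : Finset (H ⧸ A) := {(x : H ⧸ A), (y : H ⧸ A), ((x * y : H) : H ⧸ A)}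
  let S : Finset H := {1, x, y, x * y}
  let f : H → (H ⧸ A) × (H ⧸ A) := fun g =>
    (((g * x * g⁻¹ : H) : H ⧸ A), ((g * y * g⁻¹ : H) : H ⧸ A))
  have hT : ∀ g : H, ∀ t ∈ B, t ∉ A → ((g * t * g⁻¹ : H) : H ⧸ A) ∈ T := by
    intro g t ht htA
    have hgt : g * t * g⁻¹ ∈ B := hBn.conj_mem t ht g
    have hgtA : g * t * g⁻¹ ∉ A := by
      intro h
      have := hAn.conj_mem _ h g⁻¹
      exact htA (by simpa [mul_assoc] using this)
    obtain ⟨s, hs, hgs⟩ := hBgen _ hgt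
    have heq : ((g * t * g⁻¹ : H) : H ⧸ A) = s := by
      rw [← QuotientGroup.eq_one_iff, QuotientGroup.mk_mul, mul_eq_one_iff_eq_inv] at hgs
      rw [hgs, eq_comm, ← mul_eq_one_iff_eq_inv, ← pow_two, ← QuotientGroup.mk_pow,
        QuotientGroup.eq_one_iff]
      exact hpow s (hS s hs)
    rw [heq]
    rcases hs with rfl | rfl | rfl | rfl
    · exact absurd (by simpa using hgs) hgtA
    all_goals simp [T]
  have hmaps : ∀ g ∈ Finset.univ.filter (· ∈ C), f g ∈ T.offDiag := by
    intro g _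
    rw [Finset.mem_offDiag]
    refine ⟨hT g x hx hxA, hT g y hy hyA, fun h => ?_⟩
    have h1 : (g * x * g⁻¹)⁻¹ * (g * y * g⁻¹) ∈ A := QuotientGroup.eq.1 h
    have h3 := hAn.conj_mem _ h1 g⁻¹
    have h4 : x⁻¹ * y ∈ A := by
      have : g⁻¹ * ((g * x * g⁻¹)⁻¹ * (g * y * g⁻¹)) * g⁻¹⁻¹ = x⁻¹ * y := by group
      rwa [this] at h3
    have h5 := (Commute.refl x).mul_left (hA.commute h4 (hBC hx))
    rw [mul_inv_cancel_left] at h5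
    exact hxy h5.symm
  have hfib : ∀ b ∈ T.offDiag,
      ((Finset.univ.filter (· ∈ C)).filter (fun g => f g = b)).card ≤ 4 * Nat.card A := by
    intro b _
    rcases ((Finset.univ.filter (· ∈ C)).filter (fun g => f g = b)).eq_empty_or_nonempty
      with h | ⟨g0, hg0⟩
    · rw [h]; simp
    simp only [Finset.mem_filter, Finset.mem_univ, true_and] at hg0
    have hdiff : ∀ t ∈ B, ∀ w ∈ C, ∀ g : H, g = g0 * w →
        ((g * t * g⁻¹ : H) : H ⧸ A) = ((g0 * t * g0⁻¹ : H) : H ⧸ A) →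
        w * t = t * w ∨ w * t = z * (t * w) := by
      rintro t ht w hw g rfl h
      have h1 : (g0 * t * g0⁻¹)⁻¹ * (g0 * w * t * (g0 * w)⁻¹) ∈ A := QuotientGroup.eq.1 h.symm
      have h3 := hAn.conj_mem _ h1 g0⁻¹
      set u := t⁻¹ * (w * t * w⁻¹) with hu
      have h4 : u ∈ A := by
        have : g0⁻¹ * ((g0 * t * g0⁻¹)⁻¹ * (g0 * w * t * (g0 * w)⁻¹)) * g0⁻¹⁻¹ = u := by
          rw [hu]; group
        rwa [this] at h3
      have hut : Commute u t := hA.commute h4 (hBC ht)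
      have hwt : w * t = u * (t * w) := by
        rw [← mul_assoc, hut.eq, hu]; group
      have hu2 : u * u = 1 := by
        rw [← pow_two]; exact hA.pow_eq_one_of_mul_eq hw (hBC ht) h4 (hpow t ht) hwt
      rcases hA.eq_one_or_eq_of_mul_self hz hz1 hz2 h4 hu2 with h | h
      · left; rwa [h, one_mul] at hwt
      · right; rwa [h] at hwt
    have hsub : (Finset.univ.filter (· ∈ C)).filter (fun g => f g = b) ⊆
        ((Finset.univ.filter (· ∈ A)) ×ˢ S).image (fun r => g0 * r.1 * r.2⁻¹) := by
      intro g hg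
      simp only [Finset.mem_filter, Finset.mem_univ, true_and] at hg
      have hfg : f g = f g0 := hg.2.trans hg0.2.symm
      obtain ⟨s, hs, hws⟩ := hadj (g0⁻¹ * g) (mul_mem (inv_mem hg0.1) hg.1)
        (hdiff x hx _ (mul_mem (inv_mem hg0.1) hg.1) g (by group) (congrArg Prod.fst hfg))
        (hdiff y hy _ (mul_mem (inv_mem hg0.1) hg.1) g (by group) (congrArg Prod.snd hfg))
      rw [Finset.mem_image]
      refine ⟨(g0⁻¹ * g * s, s), ?_, by group⟩
      rw [Finset.mem_product, Finset.mem_filter]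
      exact ⟨⟨Finset.mem_univ _, hws⟩, by simpa [S] using hs⟩
    refine (Finset.card_le_card hsub).trans (Finset.card_image_le.trans ?_)
    rw [Finset.card_product, mul_comm, ← Fintype.card_subtype, ← Nat.card_eq_fintype_card]
    exact Nat.mul_le_mul_right _ Finset.card_le_four
  have hcard := Finset.card_le_mul_card_image_of_maps_to hmaps _ hfib
  rw [← Fintype.card_subtype, ← Nat.card_eq_fintype_card] at hcard
  have hTcard : T.offDiag.card ≤ 6 := by
    rw [Finset.offDiag_card]
    have : T.card ≤ 3 := Finset.card_le_three
    generalize T.card = k at this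
    interval_cases k <;> simp
  calc Nat.card C ≤ 4 * Nat.card A * T.offDiag.card := hcard
    _ ≤ 4 * Nat.card A * 6 := Nat.mul_le_mul_left _ hTcard
    _ = 24 * Nat.card A := by ring

end Subgroup.IsMaxCyclicNormal

end MaximalAbelianNormal

section Counting

theorem Subgroup.card_eq_ncard_conjugatesOf_mul {H : Type*} [Group H] (a : H) :
    Nat.card H = (conjugatesOf a).ncard * Nat.card (Subgroup.centralizer {a}) := by
  have h : MulAction.orbit (ConjAct H) a = conjugatesOf a := by
    rw [ConjAct.orbit_eq_carrier_conjClasses, ConjClasses.carrier_eq_preimage_mk]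
    ext x
    exact ConjClasses.mk_eq_mk_iff_isConj.trans isConj_comm
  rw [Subgroup.nat_card_centralizer_nat_card_stabilizer, ← h, ← MulAction.index_stabilizer,
    Subgroup.index_mul_card]
  rfl

theorem MagnusProperty.totient_card_le {H : Type*} [Group H] [Finite H] (hMP : MagnusProperty H)
    {A : Subgroup H} (hA : A.Normal) {a : H} (ha : Subgroup.zpowers a = A) :
    (Nat.card A).totient ≤ 2 * (conjugatesOf a).ncard := by
  classical
  let _ := Fintype.ofFinite H
  have hcyc : IsCyclic A := by rw [← ha]; infer_instance
  have hgen : ∀ x : H, Subgroup.zpowers x = A → Subgroup.normalClosure {x} = A := by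
    intro x hx
    refine le_antisymm (Subgroup.normalClosure_le_normal ?_) ?_
    · rw [Set.singleton_subset_iff, ← hx]
      exact Subgroup.mem_zpowers x
    · rw [← hx, Subgroup.zpowers_le]
      exact Subgroup.subset_normalClosure rfl
  have hsub : (Subtype.val '' {x : A | orderOf x = Nat.card A}) ⊆
      conjugatesOf a ∪ Inv.inv '' conjugatesOf a := by
    rintro _ ⟨x, hx, rfl⟩
    have hxA : Subgroup.zpowers (x : H) = A := by
      refine Subgroup.eq_of_le_of_card_ge ((Subgroup.zpowers_le).2 x.2) ?_
      rw [Nat.card_zpowers, Subgroup.orderOf_coe]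
      exact hx.ge
    rcases hMP a x ((hgen a ha).trans (hgen x hxA).symm) with h | h
    · exact Or.inl h
    · exact Or.inr ⟨_, h, inv_inv _⟩
  have hcard : ({x : A | orderOf x = Nat.card A}).ncard = (Nat.card A).totient := by
    have h := IsCyclic.card_orderOf_eq_totient (α := A) (d := Nat.card A)
      (by rw [Nat.card_eq_fintype_card])
    rw [← h, ← Set.ncard_coe_finset]
    congr 1
    ext x
    simp
  rw [← hcard, ← Set.ncard_image_of_injective _ Subtype.val_injective]
  refine (Set.ncard_le_ncard hsub (Set.toFinite _)).trans ((Set.ncard_union_le _ _).trans ?_)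
  have := Set.ncard_image_le (f := Inv.inv) (Set.toFinite (conjugatesOf a))
  omega

variable {H V : Type*} [Group H] [AddCommGroup V] [Nontrivial V] [DistribMulAction H V]

theorem card_le_of_transitive_action [Finite H] [Finite V]
    (htr : ∀ v w : V, v ≠ 0 → w ≠ 0 → ∃ h : H, h • v = w ∨ h • v = -w) :
    Nat.card V ≤ 2 * Nat.card H + 1 := by
  obtain ⟨v, hv⟩ := exists_ne (0 : V)
  have hsub : (Set.univ : Set V) ⊆
      insert 0 ((Set.range fun h : H => h • v) ∪ Set.range fun h : H => -(h • v)) := by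
    intro w _
    by_cases hw : w = 0
    · exact Or.inl hw
    · obtain ⟨h, rfl | h'⟩ := htr v w hv hw
      · exact Or.inr (Or.inl ⟨h, rfl⟩)
      · exact Or.inr (Or.inr ⟨h, by simp [h']⟩)
  have hrange : ∀ f : H → V, (Set.range f).ncard ≤ Nat.card H := by
    intro f
    rw [← Set.image_univ, ← Set.ncard_univ]
    exact Set.ncard_image_le (Set.toFinite _)
  rw [← Set.ncard_univ]
  refine (Set.ncard_le_ncard hsub (Set.toFinite _)).trans ((Set.ncard_insert_le _ _).trans ?_)
  have := Set.ncard_union_le (Set.range fun h : H => h • v) (Set.range fun h : H => -(h • v))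
  have h1 := hrange fun h : H => h • v
  have h2 := hrange fun h : H => -(h • v)
  omega

theorem card_le_of_transitive_action_of_even [Finite H] [Finite V]
    (hfpf : ∀ (h : H) (v : V), v ≠ 0 → h • v = v → h = 1)
    (htr : ∀ v w : V, v ≠ 0 → w ≠ 0 → ∃ h : H, h • v = w ∨ h • v = -w)
    (h2 : 2 ∣ Nat.card H) : Nat.card V ≤ Nat.card H + 1 := by
  obtain ⟨v, hv⟩ := exists_ne (0 : V)
  obtain ⟨t, ht⟩ := exists_prime_orderOf_dvd_card' 2 h2
  have ht1 : t ≠ 1 := fun h => by simp [h] at ht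
  have htt : t * t = 1 := by rw [← pow_two, ← ht, pow_orderOf_eq_one]
  have hneg : ∀ w : V, t • w = -w := by
    intro w
    by_contra hne
    refine ht1 (hfpf t (t • w + w) (fun h => hne (eq_neg_of_add_eq_zero_left h)) ?_)
    rw [smul_add, ← mul_smul, htt, one_smul, add_comm]
  have hsub : (Set.univ : Set V) ⊆ insert 0 (Set.range fun h : H => h • v) := by
    intro w _
    by_cases hw : w = 0
    · exact Or.inl hw
    · obtain ⟨h, rfl | h'⟩ := htr v w hv hw
      · exact Or.inr ⟨h, rfl⟩
      · exact Or.inr ⟨t * h, by simp only [mul_smul, h', hneg, neg_neg]⟩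
  have hrange : (Set.range fun h : H => h • v).ncard ≤ Nat.card H := by
    rw [← Set.image_univ, ← Set.ncard_univ (α := H)]
    exact Set.ncard_image_le (Set.toFinite _)
  rw [← Set.ncard_univ]
  refine (Set.ncard_le_ncard hsub (Set.toFinite _)).trans ((Set.ncard_insert_le _ _).trans ?_)
  omega

theorem two_le_finrank_of_not_commute [Finite V] {K : Type*} [Field K] [Module K V] {x y : H}
    (hfpf : ∀ (h : H) (v : V), v ≠ 0 → h • v = v → h = 1)
    (hx : ∀ (c : K) (v : V), x • c • v = c • x • v)
    (hy : ∀ (c : K) (v : V), y • c • v = c • y • v) (hxy : ¬ Commute x y) :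
    2 ≤ Module.finrank K V := by
  have hfin : Module.Finite K V := Module.Finite.of_finite
  have hpos : 0 < Module.finrank K V := Module.finrank_pos
  by_contra hlt
  obtain ⟨v, hv, hspan⟩ := finrank_eq_one_iff'.1 (show Module.finrank K V = 1 by omega)
  obtain ⟨c, hc⟩ := hspan (x • v)
  obtain ⟨d, hd⟩ := hspan (y • v)
  refine hxy ?_
  have h : (y * x)⁻¹ * (x * y) = 1 := by
    refine hfpf _ v hv ?_
    rw [mul_smul, inv_smul_eq_iff, mul_smul, mul_smul, ← hd, hx, ← hc, hy, ← hd, smul_comm]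
  exact (inv_mul_eq_one.1 h).symm

end Counting

theorem Nat.le_six_of_totient_le_two {m : ℕ} (h : m.totient ≤ 2) : m ≤ 6 := by
  have hm : m ≤ 8 := by
    have := Nat.le_two_mul_totient_sq m
    nlinarith
  by_contra hlt
  interval_cases m <;> revert h <;> decide

theorem Nat.le_twelve_of_totient_le_four {m : ℕ} (h : m.totient ≤ 4) : m ≤ 12 := by
  have hm : m ≤ 32 := by
    have := Nat.le_two_mul_totient_sq m
    nlinarith
  by_contra hlt
  interval_cases m <;> revert h <;> decide

theorem lt_eleven_of_card_le {p e m h n : ℕ} (he : 1 ≤ e) (hm : m.totient ≤ 2 * e)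
    (hh : h ≤ e * m) (hmh : m ∣ h) (hn : p ^ e ≤ n) (hn1 : n ≤ 2 * h + 1)
    (hn2 : 2 ∣ h → n ≤ h + 1) : p < 11 := by
  by_contra! hp
  have h11 : 11 ^ e ≤ n := (Nat.pow_le_pow_left hp e).trans hn
  obtain rfl | rfl | he3 : e = 1 ∨ e = 2 ∨ 3 ≤ e := by omega
  · have hm6 : m ≤ 6 := Nat.le_six_of_totient_le_two hm
    by_cases h2 : 2 ∣ h
    · have := hn2 h2
      omega
    · have hm2 : ¬ 2 ∣ m := fun h => h2 (h.trans hmh)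
      have hm5 : m ≠ 5 := by
        rintro rfl
        revert hm
        decide
      omega
  · have := Nat.le_twelve_of_totient_le_four hm
    omega
  · have h1 := Nat.le_two_mul_totient_sq m
    have h2 : m.totient ^ 2 ≤ (2 * e) ^ 2 := Nat.pow_le_pow_left hm 2
    have h3 : e * m ≤ e * (8 * e ^ 2) := Nat.mul_le_mul_left e (by nlinarith)
    have h4 : 16 * e ^ 3 + 1 < 11 ^ e := by
      clear * - he3
      induction e, he3 using Nat.le_induction with
      | base => norm_num
      | succ e he ih =>
        rw [pow_succ 11]
        nlinarith [Nat.mul_le_mul he he, Nat.pow_le_pow_left he 3]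
    have h5 : e * (8 * e ^ 2) = 8 * e ^ 3 := by ring
    omega

theorem lt_eleven_of_card_le_of_even {p d e m h n : ℕ} (hp : p.Prime) (he : 1 ≤ e) (hed : e ≤ d)
    (hm : m.totient ≤ 2 * e) (hh : h ≤ e * (24 * m)) (hmd : m ∣ p ^ d - 1)
    (hn : (p ^ d) ^ 2 ≤ n) (hn1 : n ≤ h + 1) : p < 11 := by
  by_contra! hp11
  have h11 : (11 ^ d) ^ 2 ≤ n :=
    (Nat.pow_le_pow_left (Nat.pow_le_pow_left hp11 d) 2).trans hn
  obtain rfl | he2 : e = 1 ∨ 2 ≤ e := by omega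
  · have hm6 : m ≤ 6 := Nat.le_six_of_totient_le_two hm
    have hd : p ^ d < 13 := by
      by_contra! h13
      have := Nat.pow_le_pow_left h13 2
      omega
    have hd1 : d = 1 := by
      by_contra hne
      have h1 : 11 ^ 2 ≤ p ^ d :=
        (Nat.pow_le_pow_left hp11 2).trans (Nat.pow_le_pow_right hp.pos (by omega))
      omega
    subst hd1
    rw [pow_one] at hd hmd hn
    have hp' : p = 11 := by
      by_contra hne
      obtain rfl : p = 12 := by omega
      revert hp; norm_num
    subst hp'
    have hm2 : m ≤ 2 := by
      by_contra hlt
      interval_cases m <;> revert hm hmd <;> decide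
    omega
  · have h1 := Nat.le_two_mul_totient_sq m
    have h2 : m.totient ^ 2 ≤ (2 * e) ^ 2 := Nat.pow_le_pow_left hm 2
    have h3 : e * (24 * m) ≤ e * (24 * (8 * e ^ 2)) :=
      Nat.mul_le_mul_left e (Nat.mul_le_mul_left 24 (by nlinarith))
    have h4 : 192 * e ^ 3 + 1 < (11 ^ e) ^ 2 := by
      clear * - he2
      induction e, he2 using Nat.le_induction with
      | base => norm_num
      | succ e he ih =>
        rw [pow_succ 11, mul_pow]
        nlinarith [Nat.mul_le_mul he he, Nat.pow_le_pow_left he 3]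
    have h5 : e * (24 * (8 * e ^ 2)) = 192 * e ^ 3 := by ring
    have h6 : (11 ^ e) ^ 2 ≤ (11 ^ d) ^ 2 :=
      Nat.pow_le_pow_left (Nat.pow_le_pow_right (by norm_num) hed) 2
    omega

theorem Subgroup.exists_maximal_commutative_normal {H : Type*} [Group H] [Finite H] :
    ∃ A : Subgroup H, A.Normal ∧ (∀ x ∈ A, ∀ y ∈ A, x * y = y * x) ∧
      ∀ B : Subgroup H, B.Normal → A ≤ B → (∀ x ∈ B, ∀ y ∈ B, x * y = y * x) → B ≤ A := by
  obtain ⟨A, hA⟩ := (Set.toFinite {A : Subgroup H | A.Normal ∧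
    ∀ x ∈ A, ∀ y ∈ A, x * y = y * x}).exists_maximal
    ⟨⊥, inferInstance, fun x hx y hy => by rw [Subgroup.mem_bot.1 hx, Subgroup.mem_bot.1 hy]⟩
  exact ⟨A, hA.prop.1, hA.prop.2, fun B hB hAB hcomm => hA.le_of_ge ⟨hB, hcomm⟩ hAB⟩

theorem lt_eleven_of_transitive_action {H V : Type*} [Group H] [Finite H] [AddCommGroup V]
    [Finite V] [Nontrivial V] [DistribMulAction H V] {p : ℕ} (hp : p.Prime)
    (hpV : ∀ v : V, p • v = 0)
    (hfpf : ∀ (h : H) (v : V), v ≠ 0 → h • v = v → h = 1)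
    (htr : ∀ v w : V, v ≠ 0 → w ≠ 0 → ∃ h : H, h • v = w ∨ h • v = -w)
    (hMP : MagnusProperty H) : p < 11 := by
  obtain ⟨A, hAn, hAcomm, hAmax⟩ := Subgroup.exists_maximal_commutative_normal (H := H)
  obtain ⟨K, _, _, _, ι, hι, hcl⟩ := exists_field_of_transitive_action htr A hAn hAcomm
  have hinj := injective_of_smul_eq hfpf hι
  have hcyc : IsCyclic A := isCyclic_of_injective_ringHom ι hinj
  have hA : A.IsMaxCyclicNormal := ⟨hAn, hcyc, hAmax, fun q hq hqA y hy hyq =>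
    mem_of_mem_centralizer_of_pow_eq_one hfpf hι hcl hq hqA hy hyq⟩
  obtain ⟨a, ha⟩ := IsCyclic.exists_zpow_surjective (G := A)
  have haA : Subgroup.zpowers (a : H) = A := by
    refine le_antisymm (Subgroup.zpowers_le.2 a.2) fun x hx => ?_
    obtain ⟨k, hk⟩ := ha ⟨x, hx⟩
    exact ⟨k, congrArg Subtype.val hk⟩
  have hcent : Subgroup.centralizer {(a : H)} = Subgroup.centralizer (A : Set H) := by
    rw [← Subgroup.centralizer_closure, ← Subgroup.zpowers_eq_closure, haA]
  -- the field `K` has order `p ^ d`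
  have hchar : CharP K p := by
    obtain ⟨v, hv⟩ := exists_ne (0 : V)
    refine (CharP.charP_iff_prime_eq_zero hp).2 ?_
    have h : (p : K) • v = 0 := by rw [Nat.cast_smul_eq_nsmul, hpV]
    exact (smul_eq_zero.1 h).resolve_right hv
  obtain ⟨d, hd⟩ : ∃ d : ℕ, Nat.card K = p ^ d := by
    let _ := Fintype.ofFinite K
    obtain ⟨d, -, hd⟩ := FiniteField.card K p
    exact ⟨d, by rw [Nat.card_eq_fintype_card, hd]⟩
  have hfin : Module.Finite K V := Module.Finite.of_finite
  have hV : Nat.card V = (p ^ d) ^ Module.finrank K V := by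
    rw [← hd, Module.natCard_eq_pow_finrank (K := K)]
  have hpd : 0 < p ^ d := Nat.pow_pos hp.pos
  set e := (conjugatesOf (a : H)).ncard with hedef
  have he : 1 ≤ e := (Set.ncard_pos (Set.toFinite _)).2 ⟨a, IsConj.refl (a : H)⟩
  have hed : e ≤ d := ncard_conjugatesOf_le hp hpV hfpf hAn hι hd a
  have hm := hMP.totient_card_le hAn haA
  have hH := Subgroup.card_eq_ncard_conjugatesOf_mul (a : H)
  rw [hcent] at hH
  by_cases hCA : Subgroup.centralizer (A : Set H) ≤ A
  · refine lt_eleven_of_card_le he hm (h := Nat.card H) (n := Nat.card V) ?_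
      A.card_subgroup_dvd_card ?_ (card_le_of_transitive_action htr)
      (card_le_of_transitive_action_of_even hfpf htr)
    · rw [hH]
      exact Nat.mul_le_mul_left e (Subgroup.card_le_of_le hCA)
    · rw [hV]
      exact (Nat.pow_le_pow_right hp.pos hed).trans
        (Nat.le_self_pow Module.finrank_pos.ne' _)
  · obtain ⟨h2, hcard⟩ := hA.card_centralizer_le hMP hCA
    obtain ⟨x, hx, y, hy, hxy⟩ : ∃ x ∈ Subgroup.centralizer (A : Set H),
        ∃ y ∈ Subgroup.centralizer (A : Set H), ¬ Commute x y := by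
      by_contra! hcon
      exact hCA (hAmax _ inferInstance hA.le_centralizer fun x hx y hy => hcon x hx y hy)
    have hrank := two_le_finrank_of_not_commute hfpf (hcl x hx) (hcl y hy) hxy
    refine lt_eleven_of_card_le_of_even hp he hed hm (h := Nat.card H) (n := Nat.card V) ?_ ?_ ?_
      (card_le_of_transitive_action_of_even hfpf htr (h2.trans A.card_subgroup_dvd_card))
    · rw [hH]
      exact Nat.mul_le_mul_left e hcard
    · rw [← hd, ← Nat.card_units]
      exact Subgroup.card_dvd_of_injective (ι.toHomUnits)
        fun x y hxy => hinj (congrArg Units.val hxy)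
    · rw [hV]
      exact Nat.pow_le_pow_right hpd hrank

theorem MagnusProperty.prime_lt_eleven {p : ℕ} (hp : p.Prime) (n : ℕ) :
    ∀ (G : Type*) [Group G] [Finite G], MagnusProperty G → Nat.card G = n → p ∣ Nat.card G →
      p < 11 := by
  induction n using Nat.strong_induction_on with
  | _ n ih =>
  intro G _ _ hG hn hpG
  by_contra hp11
  have hfact := Fact.mk hp
  -- proper quotients have order prime to `p`
  have hquot : ∀ W : Subgroup G, W.Normal → W ≠ ⊥ → ¬ p ∣ Nat.card (G ⧸ W) := by
    intro W hW hbot hdvd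
    have hlt : Nat.card (G ⧸ W) < n := by
      rw [← hn, W.card_eq_card_quotient_mul_card_subgroup]
      have h1 : 1 < Nat.card W := W.one_lt_card_iff_ne_bot.2 hbot
      have h2 : 0 < Nat.card (G ⧸ W) := Nat.card_pos
      nlinarith
    exact hp11 (ih _ hlt (G ⧸ W) (hG.quotient_s5 W) rfl hdvd)
  have hcard : ∀ W : Subgroup G, W.Normal → W ≠ ⊥ → p ∣ Nat.card W := by
    intro W hW hbot
    rw [W.card_eq_card_quotient_mul_card_subgroup] at hpG
    exact (hp.dvd_mul.1 hpG).resolve_left (hquot W hW hbot)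
  have htop : (⊤ : Subgroup G) ≠ ⊥ := by
    intro h
    have h1 : Nat.card G = 1 := by
      rw [← Subgroup.card_top, h, Subgroup.card_bot]
    rw [h1] at hpG
    exact hp.one_lt.ne' (Nat.dvd_one.1 hpG)
  obtain ⟨N, hN, -⟩ := Subgroup.exists_isMinimalNormal_le (⊤ : Subgroup G) inferInstance htop
  have hNn := hN.normal
  have hpN := hcard N hNn hN.ne_bot
  -- `N` is the Sylow `p`-subgroup
  have hsylow : ∀ (x : G) (k : ℕ), x ^ p ^ k = 1 → x ∈ N := by
    intro x k hx
    rw [← QuotientGroup.eq_one_iff]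
    have h1 : (x : G ⧸ N) ^ p ^ k = 1 := by rw [← QuotientGroup.mk_pow, hx]; rfl
    have h2 : (x : G ⧸ N) ^ Nat.card (G ⧸ N) = 1 := pow_card_eq_one'
    have h3 := pow_gcd_eq_one.2 ⟨h1, h2⟩
    rwa [((hp.coprime_iff_not_dvd.2 (hquot N hNn hN.ne_bot)).pow_left k).gcd_eq_one,
      pow_one] at h3
  have hle : ∀ W : Subgroup G, W.Normal → W ≠ ⊥ → N ≤ W := by
    intro W hW hbot
    obtain ⟨z, hz⟩ := exists_prime_orderOf_dvd_card' p (hcard W hW hbot)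
    have hzo : orderOf (z : G) = p := by rw [Subgroup.orderOf_coe, hz]
    have hz1 : (z : G) ≠ 1 := fun h => hp.one_lt.ne' (by rw [← hzo, h, orderOf_one])
    have hzN : (z : G) ∈ N := hsylow z 1 (by rw [pow_one, ← hzo, pow_orderOf_eq_one])
    rw [← hN.normalClosure_eq hzN hz1]
    exact Subgroup.normalClosure_le_normal (by simp)
  have hfree : ∀ g : G, g ∉ N → ∀ c ∈ N, c ≠ 1 → Commute g c → False := by
    intro g hg c hc hc1 hgc
    have hr := hp.coprime_iff_not_dvd.2 (hquot N hNn hN.ne_bot)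
    set r := Nat.card (G ⧸ N) with hrdef
    have hcp : c ^ p = 1 := hN.pow_eq_one hG hp hpN hc
    have hgN : g ^ p ∉ N := by
      intro h
      exact hg (hsylow g 2 (by rw [pow_two, pow_mul]; exact hN.pow_eq_one hG hp hpN h))
    have hgr : (g ^ p) ^ r = 1 := by
      rw [← pow_mul, mul_comm, pow_mul]
      refine hN.pow_eq_one hG hp hpN ?_
      rw [← QuotientGroup.eq_one_iff, QuotientGroup.mk_pow]
      exact pow_card_eq_one'
    have hcl : ∀ x : G, x ∉ N → N ≤ Subgroup.normalClosure {x} := by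
      intro x hx
      refine hle _ Subgroup.normalClosure_normal fun h => hx ?_
      have : x ∈ Subgroup.normalClosure {x} := Subgroup.subset_normalClosure rfl
      rw [h, Subgroup.mem_bot] at this
      rw [this]; exact N.one_mem
    have hcgN : c * g ^ p ∉ N := fun h => hgN ((N.mul_mem_cancel_left hc).1 h)
    have heq : Subgroup.normalClosure {c * g ^ p} = Subgroup.normalClosure {g ^ p} := by
      refine le_antisymm (Subgroup.normalClosure_le_normal ?_)
        (Subgroup.normalClosure_le_normal ?_)
      · rw [Set.singleton_subset_iff]
        exact mul_mem (hcl _ hgN hc) (Subgroup.subset_normalClosure rfl)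
      · rw [Set.singleton_subset_iff]
        exact (Subgroup.mul_mem_cancel_left _ (hcl _ hcgN hc)).1
          (Subgroup.subset_normalClosure rfl)
    have hord : orderOf (c * g ^ p) = orderOf (g ^ p) := by
      rcases hG _ _ heq with h | h
      · exact h.orderOf_eq_orderOf
      · rw [h.orderOf_eq_orderOf, orderOf_inv]
    have h1 : (c * g ^ p) ^ r = 1 := by
      rw [← orderOf_dvd_iff_pow_eq_one, hord, orderOf_dvd_iff_pow_eq_one, hgr]
    rw [((hgc.pow_left p).symm).mul_pow, hgr, mul_one] at h1
    have h3 := pow_gcd_eq_one.2 ⟨hcp, h1⟩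
    rw [hr.gcd_eq_one, pow_one] at h3
    exact hc1 h3
  -- the conjugation action of `G ⧸ N` on `N`
  let _ : CommGroup N :=
    { (inferInstance : Group N) with
      mul_comm := fun x y => Subtype.ext (hN.mul_comm hG x.2 y.2) }
  let f : G ⧸ N →* MulAut N := QuotientGroup.lift N MulAut.conjNormal (by
    intro x hx
    ext y
    simp [hN.mul_comm hG hx y.2])
  let act : DistribMulAction (G ⧸ N) (Additive N) :=
    { smul := fun g v => Additive.ofMul (f g v.toMul)
      one_smul := fun v => by
        change Additive.ofMul (f 1 v.toMul) = v
        simp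
      mul_smul := fun g h v => by
        change Additive.ofMul (f (g * h) v.toMul) = Additive.ofMul (f g (f h v.toMul))
        rw [map_mul]; rfl
      smul_zero := fun g => by
        change Additive.ofMul (f g 1) = 0
        simp
      smul_add := fun g v w => by
        change Additive.ofMul (f g (v.toMul * w.toMul)) =
          Additive.ofMul (f g v.toMul * f g w.toMul)
        rw [map_mul] }
  have hsmul : ∀ (g : G) (v : N), ((f (g : G ⧸ N) v : N) : G) = g * v * g⁻¹ := fun g v => rfl
  have hNt : Nontrivial N := (Subgroup.nontrivial_iff_ne_bot N).2 hN.ne_bot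
  refine hp11 (lt_eleven_of_transitive_action (H := G ⧸ N) (V := Additive N) hp ?_ ?_ ?_
    (hG.quotient_s5 N))
  · intro v
    refine Additive.toMul.injective (Subtype.ext ?_)
    simpa using hN.pow_eq_one hG hp hpN (Additive.toMul v).2
  · intro h v hv hhv
    obtain ⟨g, rfl⟩ := QuotientGroup.mk_surjective h
    by_contra hg
    rw [QuotientGroup.eq_one_iff] at hg
    refine hfree g hg (Additive.toMul v : N) (Additive.toMul v).2 ?_ ?_
    · intro h1
      exact hv (Additive.toMul.injective (Subtype.ext h1))
    · have h2 := hsmul g (Additive.toMul v)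
      have h3 : f (g : G ⧸ N) (Additive.toMul v) = Additive.toMul v :=
        congrArg Additive.toMul hhv
      rw [h3, eq_mul_inv_iff_mul_eq] at h2
      exact h2.symm
  · intro v w hv hw
    have hv1 : ((Additive.toMul v : N) : G) ≠ 1 := fun h1 =>
      hv (Additive.toMul.injective (Subtype.ext h1))
    have hw1 : ((Additive.toMul w : N) : G) ≠ 1 := fun h1 =>
      hw (Additive.toMul.injective (Subtype.ext h1))
    rcases hN.isConj hG (Additive.toMul v).2 hv1 (Additive.toMul w).2 hw1 with h | h
    · obtain ⟨g, hg⟩ := isConj_iff.1 h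
      refine ⟨(g : G ⧸ N), Or.inl (Additive.toMul.injective (Subtype.ext ?_))⟩
      exact (hsmul g (Additive.toMul v)).trans hg
    · obtain ⟨g, hg⟩ := isConj_iff.1 h
      refine ⟨(g : G ⧸ N), Or.inr (Additive.toMul.injective (Subtype.ext ?_))⟩
      exact (hsmul g (Additive.toMul v)).trans hg

theorem finite_MP_prime_divisors (G : Type*) [Group G] [Finite G] [Nontrivial G]
    (hG : MagnusProperty G) (p : ℕ) (hp : p.Prime) (hdvd : p ∣ Nat.card G) :
    p ∈ ({2, 3, 5, 7} : Set ℕ) := by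
  have h := hG.prime_lt_eleven hp _ G rfl hdvd
  interval_cases p <;> revert hp <;> simp <;> decide
end
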